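/- arXiv:1804.07502 — 2 statements merged into one kernel-verified Lean document; each statement's English description precedes it below -/
import Mathlib

section
/- Let d ≥ 2, W : ℝ^d → [0,∞) continuous, a ∈ ℝ, and u^± ∈ S_a two wells of W. Then geod^a_W(u^-,u^+) equals the infimum of ∫_ℝ ½|γ̇(t)|² + W(γ(t)) dt over all γ ∈ Ḣ¹(ℝ,ℝ^d_a) with γ(±∞) = u^±. In particular, if γ is a minimizer of this one-dimensional problem, then its energy equals geod^a_W(u^-,u^+), equals its weighted length L_W(γ) = ∫_ℝ √(2W(γ(t))) |γ̇(t)| dt, and equipartition holds: |γ̇(t)| = √(2W(γ(t))) for a.e. t ∈ ℝ. -/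
open MeasureTheory Filter Topology ENNReal

noncomputable section

/-- Squared Euclidean norm on `ℝ^d` (modelled as `Fin d → ℝ`). -/
def vnorm2 {d : ℕ} (v : Fin d → ℝ) : ℝ := ∑ i, v i ^ 2

/-- Partial derivative in the `i`-th coordinate direction of a map `ℝ^d → ℝ^d`. -/
def pd {d : ℕ} (i : Fin d) (u : (Fin d → ℝ) → Fin d → ℝ) (x : Fin d → ℝ) : Fin d → ℝ :=
  fderiv ℝ u x (Pi.single i 1)

/-- Partial derivative in the `i`-th coordinate direction of a scalar function on `ℝ^d`. -/
def pdS {d : ℕ} (i : Fin d) (w : (Fin d → ℝ) → ℝ) (x : Fin d → ℝ) : ℝ :=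
  fderiv ℝ w x (Pi.single i 1)

/-- Squared Frobenius norm `|∇u|²` of the Jacobian of `u`. -/
def gradSq {d : ℕ} (u : (Fin d → ℝ) → Fin d → ℝ) (x : Fin d → ℝ) : ℝ :=
  ∑ i, ∑ j, (pd i u x j) ^ 2

/-- Divergence-free condition `∇ ⋅ u = 0`. -/
def IsDivFree {d : ℕ} (u : (Fin d → ℝ) → Fin d → ℝ) : Prop :=
  ∀ x, ∑ i, pd i u x i = 0

/-- Periodicity (period 1) in the last `d-1` coordinates: `u` is a map on `Ω = ℝ × 𝕋^{d-1}`. -/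
def IsPeriodic {d : ℕ} [NeZero d] (u : (Fin d → ℝ) → Fin d → ℝ) : Prop :=
  ∀ (x : Fin d → ℝ) (i : Fin d), i ≠ 0 → u (x + Pi.single i 1) = u x

/-- Fundamental domain `ℝ × [0,1)^{d-1}` of `Ω = ℝ × 𝕋^{d-1}`. -/
def strip (d : ℕ) [NeZero d] : Set (Fin d → ℝ) :=
  {x | ∀ i : Fin d, i ≠ 0 → x i ∈ Set.Ico (0 : ℝ) 1}

/-- The unit cube `[0,1)^d`. -/
def cube (d : ℕ) : Set (Fin d → ℝ) := Set.univ.pi fun _ => Set.Ico (0 : ℝ) 1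

/-- The `x'`-average `ū(t) = ∫_{𝕋^{d-1}} u(t,x') dx'`. -/
def avg {d : ℕ} [NeZero d] (u : (Fin d → ℝ) → Fin d → ℝ) (t : ℝ) : Fin d → ℝ :=
  ∫ y in cube d, u (Function.update y 0 t)

/-- Energy density `½|∇u|² + W(u)`. -/
def eden {d : ℕ} (W : (Fin d → ℝ) → ℝ) (u : (Fin d → ℝ) → Fin d → ℝ) (x : Fin d → ℝ) : ℝ :=
  (1 / 2) * gradSq u x + W (u x)

/-- Total energy `E(u)` on `Ω`, with values in `[0,∞]`. -/
def energy (d : ℕ) [NeZero d] (W : (Fin d → ℝ) → ℝ) (u : (Fin d → ℝ) → Fin d → ℝ) : ℝ≥0∞ :=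
  ∫⁻ x in strip d, ENNReal.ofReal (eden W u x)

/-- Membership in `Ḣ¹_div(Ω, ℝ^d)` (with classical derivatives). -/
def Adm (d : ℕ) [NeZero d] (u : (Fin d → ℝ) → Fin d → ℝ) : Prop :=
  Differentiable ℝ u ∧ IsPeriodic u ∧ IsDivFree u ∧ IntegrableOn (gradSq u) (strip d)

/-- The boundary conditions `ū(-∞) = u⁻`, `ū(+∞) = u⁺`. -/
def BdryCond (d : ℕ) [NeZero d] (u : (Fin d → ℝ) → Fin d → ℝ) (um up : Fin d → ℝ) : Prop :=
  Tendsto (avg u) atBot (𝓝 um) ∧ Tendsto (avg u) atTop (𝓝 up)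

/-- `S_a`: the zeros of `W` in the hyperplane `{z₁ = a}`. -/
def wellSet (d : ℕ) [NeZero d] (W : (Fin d → ℝ) → ℝ) (a : ℝ) : Set (Fin d → ℝ) :=
  {z | z 0 = a ∧ W z = 0}

/-- Hypothesis (H2): `liminf_{z₁ → a, |z'| → ∞} W(z₁,z') > 0`. -/
def H2cond (d : ℕ) [NeZero d] (W : (Fin d → ℝ) → ℝ) (a : ℝ) : Prop :=
  ∃ c > (0 : ℝ), ∃ δ > (0 : ℝ), ∃ R : ℝ, ∀ z : Fin d → ℝ,
    |z 0 - a| < δ → R ≤ ∑ i, (if i = (0 : Fin d) then 0 else z i ^ 2) → c ≤ W z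

/-- An admissible one-dimensional transition layer: a curve in the hyperplane `{z₁ = a}`
connecting `u⁻` (at `-∞`) to `u⁺` (at `+∞`). -/
def Adm1D (d : ℕ) [NeZero d] (a : ℝ) (um up : Fin d → ℝ) (γ : ℝ → Fin d → ℝ) : Prop :=
  Differentiable ℝ γ ∧ (∀ t, γ t 0 = a) ∧
  Tendsto γ atBot (𝓝 um) ∧ Tendsto γ atTop (𝓝 up)

/-- One-dimensional energy `∫_ℝ ½|γ̇|² + W(γ)`. -/
def energy1D (d : ℕ) (W : (Fin d → ℝ) → ℝ) (γ : ℝ → Fin d → ℝ) : ℝ≥0∞ :=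
  ∫⁻ t : ℝ, ENNReal.ofReal ((1 / 2) * vnorm2 (deriv γ t) + W (γ t))

/-- Geodesic (pseudo-)distance `geod^a_F(x,y)` in the hyperplane `{z₁ = a}` for the degenerate
metric `2 F g₀`: infimum of `∫_{-1}^{1} √(2F(γ)) |γ̇| dt` over Lipschitz curves in the
hyperplane joining `x` to `y`. -/
def geodA (d : ℕ) [NeZero d] (F : (Fin d → ℝ) → ℝ) (a : ℝ) (x y : Fin d → ℝ) : ℝ :=
  sInf {L | ∃ γ : ℝ → Fin d → ℝ, (∃ K : NNReal, LipschitzWith K γ) ∧ (∀ t, γ t 0 = a) ∧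
    γ (-1) = x ∧ γ 1 = y ∧
    L = ∫ t in Set.Icc (-1 : ℝ) 1, Real.sqrt (2 * F (γ t)) * Real.sqrt (vnorm2 (deriv γ t))}

lemma vnorm2_nonneg {d : ℕ} (v : Fin d → ℝ) : 0 ≤ vnorm2 v :=
  Finset.sum_nonneg fun _ _ => sq_nonneg _

lemma continuous_vnorm2 {d : ℕ} : Continuous (vnorm2 (d := d)) := by
  unfold vnorm2
  fun_prop

lemma sqrt_vnorm2_eq_norm {d : ℕ} (v : Fin d → ℝ) :
    √(vnorm2 v) = ‖WithLp.toLp 2 v‖ := by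
  simp [vnorm2, EuclideanSpace.norm_eq]

lemma sqrt_vnorm2_add_le {d : ℕ} (v w : Fin d → ℝ) :
    √(vnorm2 (v + w)) ≤ √(vnorm2 v) + √(vnorm2 w) := by
  simp only [sqrt_vnorm2_eq_norm, WithLp.toLp_add]
  exact norm_add_le _ _

lemma sqrt_vnorm2_smul {d : ℕ} (c : ℝ) (v : Fin d → ℝ) :
    √(vnorm2 (c • v)) = |c| * √(vnorm2 v) := by
  simp only [sqrt_vnorm2_eq_norm, WithLp.toLp_smul, norm_smul, Real.norm_eq_abs]

lemma sqrt_vnorm2_zero {d : ℕ} : √(vnorm2 (0 : Fin d → ℝ)) = 0 := by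
  simp [vnorm2]

lemma sqrt_vnorm2_le {d : ℕ} (v : Fin d → ℝ) : √(vnorm2 v) ≤ d * ‖v‖ := by
  rw [Real.sqrt_le_left (by positivity)]
  calc vnorm2 v ≤ (∑ i, |v i|) ^ 2 := by
        simpa [vnorm2] using Finset.sum_sq_le_sq_sum_of_nonneg
          (s := Finset.univ) (f := fun i => |v i|) fun i _ => abs_nonneg _
    _ ≤ (d * ‖v‖) ^ 2 := by
        gcongr
        calc ∑ i, |v i| ≤ ∑ _i : Fin d, ‖v‖ :=
              Finset.sum_le_sum fun i _ => norm_le_pi_norm v i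
          _ = d * ‖v‖ := by simp

/-- The norm is controlled by the Euclidean norm. -/
lemma norm_le_sqrt_vnorm2 {d : ℕ} (v : Fin d → ℝ) : ‖v‖ ≤ √(vnorm2 v) := by
  refine (pi_norm_le_iff_of_nonneg (Real.sqrt_nonneg _)).2 fun i => ?_
  refine Real.le_sqrt_of_sq_le ?_
  rw [Real.norm_eq_abs, sq_abs]
  exact Finset.single_le_sum (f := fun i => v i ^ 2) (fun _ _ => sq_nonneg _) (Finset.mem_univ i)

/-- The absolutely continuous curve issued from `x` at `-∞` with velocity `g`. -/
def curve {d : ℕ} (x : Fin d → ℝ) (g : ℝ → Fin d → ℝ) (t : ℝ) : Fin d → ℝ :=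
  x + ∫ s in Set.Iic t, g s

/-- The length of `curve x g` for the conformal metric with factor `ρ`. -/
def curveLen {d : ℕ} (ρ : (Fin d → ℝ) → ℝ) (x : Fin d → ℝ) (g : ℝ → Fin d → ℝ) : ℝ :=
  ∫ t, ρ (curve x g t) * √(vnorm2 (g t))

lemma norm_curve_le {d : ℕ} (x : Fin d → ℝ) {g : ℝ → Fin d → ℝ} (hg : Integrable g) (t : ℝ) :
    ‖curve x g t‖ ≤ ‖x‖ + ∫ s, ‖g s‖ := by
  refine (norm_add_le _ _).trans ?_
  gcongr
  exact (norm_integral_le_integral_norm _).trans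
    (setIntegral_le_integral hg.norm (ae_of_all _ fun _ => norm_nonneg _))

lemma norm_curve_sub_curve_le {d : ℕ} (x : Fin d → ℝ) {g h : ℝ → Fin d → ℝ}
    (hg : Integrable g) (hh : Integrable h) (t : ℝ) :
    ‖curve x h t - curve x g t‖ ≤ ∫ s, ‖h s - g s‖ := by
  have : curve x h t - curve x g t = ∫ s in Set.Iic t, (h s - g s) := by
    rw [integral_sub hh.integrableOn hg.integrableOn]
    simp [curve]
  rw [this]
  exact (norm_integral_le_integral_norm _).trans
    (setIntegral_le_integral (hh.sub hg).norm (ae_of_all _ fun _ => norm_nonneg _))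

lemma curve_sub_curve {d : ℕ} (x : Fin d → ℝ) {g : ℝ → Fin d → ℝ} (hg : Integrable g)
    (s t : ℝ) : curve x g t = curve x g s + ∫ r in s..t, g r := by
  rw [← intervalIntegral.integral_Iic_sub_Iic hg.integrableOn hg.integrableOn]
  simp [curve]

lemma continuous_curve {d : ℕ} (x : Fin d → ℝ) {g : ℝ → Fin d → ℝ} (hg : Integrable g) :
    Continuous (curve x g) := by
  rw [funext (curve_sub_curve x hg 0)]
  exact continuous_const.add
    (intervalIntegral.continuous_primitive (fun _ _ => hg.intervalIntegrable) 0)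

lemma hasDerivAt_curve {d : ℕ} (x : Fin d → ℝ) {g : ℝ → Fin d → ℝ} (hg : Integrable g)
    (hc : Continuous g) (t : ℝ) : HasDerivAt (curve x g) (g t) t := by
  rw [funext (curve_sub_curve x hg 0)]
  exact (intervalIntegral.integral_hasDerivAt_right hg.intervalIntegrable
    hc.stronglyMeasurable.stronglyMeasurableAtFilter hc.continuousAt).const_add _

lemma curve_apply_zero {d : ℕ} [NeZero d] (x : Fin d → ℝ) {g : ℝ → Fin d → ℝ}
    (hg : Integrable g) (h0 : ∀ t, g t 0 = 0) (t : ℝ) : curve x g t 0 = x 0 := by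
  have : (∫ s in Set.Iic t, g s) 0 = ∫ s in Set.Iic t, g s 0 :=
    eval_integral (fun i => (hg.eval i).integrableOn) 0
  simp [curve, this, h0]

lemma integrable_sqrt_vnorm2 {d : ℕ} {g : ℝ → Fin d → ℝ} (hg : Integrable g) :
    Integrable fun t => √(vnorm2 (g t)) := by
  refine (hg.norm.const_mul (d : ℝ)).mono'
    (continuous_vnorm2.sqrt.comp_aestronglyMeasurable hg.aestronglyMeasurable)
    (ae_of_all _ fun t => ?_)
  rw [Real.norm_of_nonneg (Real.sqrt_nonneg _)]
  exact sqrt_vnorm2_le _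

lemma integrable_speed {d : ℕ} {ρ : (Fin d → ℝ) → ℝ} (hρ : Continuous ρ) (x : Fin d → ℝ)
    {g k : ℝ → Fin d → ℝ} (hg : Integrable g) (hk : Integrable k) :
    Integrable fun t => ρ (curve x g t) * √(vnorm2 (k t)) := by
  obtain ⟨M, hM⟩ := (isCompact_closedBall (0 : Fin d → ℝ) (‖x‖ + ∫ s, ‖g s‖)).exists_bound_of_continuousOn
    hρ.continuousOn
  refine (integrable_sqrt_vnorm2 hk).bdd_mul (c := M)
    (hρ.comp (continuous_curve x hg)).aestronglyMeasurable (ae_of_all _ fun t => hM _ ?_)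
  simpa using norm_curve_le x hg t

/-- Every absolutely continuous curve in a hyperplane can be replaced by a `C¹` curve with the
same end points, with compactly supported velocity and almost the same length. -/
lemma exists_smooth_curve {d : ℕ} [NeZero d] {ρ : (Fin d → ℝ) → ℝ} (hρ : Continuous ρ)
    (hρ0 : ∀ z, 0 ≤ ρ z) (x : Fin d → ℝ) {g : ℝ → Fin d → ℝ} (hg : Integrable g) (hg0 : ∀ t, g t 0 = 0)
    {ε : ℝ} (hε : 0 < ε) :
    ∃ h : ℝ → Fin d → ℝ, Continuous h ∧ HasCompactSupport h ∧ (∀ t, h t 0 = 0) ∧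
      ∫ t, h t = ∫ t, g t ∧ curveLen ρ x h ≤ curveLen ρ x g + ε := by
  set I : ℝ := ∫ t, ‖g t‖ with hI
  have hI0 : 0 ≤ I := integral_nonneg fun _ => norm_nonneg _
  have hK := isCompact_closedBall (0 : Fin d → ℝ) (‖x‖ + I + 1)
  obtain ⟨M, hM⟩ := hK.exists_bound_of_continuousOn hρ.continuousOn
  have hM0 : 0 ≤ M := (norm_nonneg _).trans (hM 0 (by simp; positivity))
  obtain ⟨δ₀, hδ₀, huc⟩ := Metric.uniformContinuousOn_iff.1
    (hK.uniformContinuousOn_of_continuous hρ.continuousOn) (ε / (2 * (d * I + 1)))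
    (by positivity)
  set δ : ℝ := min (min (δ₀ / 3) (1 / 2)) (ε / (4 * (M * d + 1))) with hδ
  have hδpos : 0 < δ := by positivity
  have hδ1 : δ ≤ δ₀ / 3 := (min_le_left _ _).trans (min_le_left _ _)
  have hδ2 : δ ≤ 1 / 2 := (min_le_left _ _).trans (min_le_right _ _)
  have hδ3 : M * d * (2 * δ) ≤ ε / 2 := by
    have h1 : δ ≤ ε / (4 * (M * d + 1)) := min_le_right _ _
    rw [le_div_iff₀ (by positivity)] at h1
    nlinarith
  obtain ⟨k, hks, hkg, hkc, hki⟩ := hg.exists_hasCompactSupport_integral_sub_le hδpos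
  set p : ℝ → Fin d → ℝ := fun t => Function.update (k t) 0 0 with hp
  have hpc : Continuous p := hkc.update 0 continuous_const
  have hps : HasCompactSupport p :=
    hks.comp_left (g := fun v : Fin d → ℝ => Function.update v 0 0) (by simp)
  have hpi : Integrable p := hpc.integrable_of_hasCompactSupport hps
  have hpg : ∫ t, ‖g t - p t‖ ≤ δ := by
    refine (integral_mono (hg.sub hpi).norm (hg.sub hki).norm fun t => ?_).trans hkg
    refine (pi_norm_le_iff_of_nonneg (norm_nonneg _)).2 fun i => ?_
    by_cases hi : i = 0
    · subst hi
      simp [hp, hg0]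
    · simpa [hp, hi] using norm_le_pi_norm (g t - k t) i
  set v : Fin d → ℝ := (∫ t, g t) - ∫ t, p t with hv
  have hvn : ‖v‖ ≤ δ := by
    rw [hv, ← integral_sub hg hpi]
    exact (norm_integral_le_integral_norm _).trans hpg
  have hcoord : ∀ {f : ℝ → Fin d → ℝ}, Integrable f → (∀ t, f t 0 = 0) → (∫ t, f t) 0 = 0 := by
    intro f hf hf0
    rw [eval_integral fun i => hf.eval i]
    simp [hf0]
  have hv0 : v 0 = 0 := by
    simp [hv, hcoord hg hg0, hcoord hpi (fun t => by simp [hp])]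
  set b : ℝ → ℝ := (default : ContDiffBump (0 : ℝ)).normed volume with hb
  have hbc : Continuous b := ContDiffBump.continuous_normed _
  have hbs : HasCompactSupport b := ContDiffBump.hasCompactSupport_normed _
  have hbi : Integrable b := ContDiffBump.integrable_normed _
  have hb1 : ∫ t, b t = 1 := ContDiffBump.integral_normed _
  have hbn : ∀ t, 0 ≤ b t := ContDiffBump.nonneg_normed _
  set h : ℝ → Fin d → ℝ := fun t => p t + b t • v with hh
  have hhc : Continuous h := by fun_prop
  have hhs : HasCompactSupport h := hps.add (hbs.smul_right (f' := fun _ => v))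
  have hhi : Integrable h := hhc.integrable_of_hasCompactSupport hhs
  have hbv : Integrable fun t => b t • v := hbi.smul_const v
  have hgh : ∫ t, ‖h t - g t‖ ≤ 2 * δ := by
    calc ∫ t, ‖h t - g t‖ ≤ ∫ t, (‖g t - p t‖ + b t * ‖v‖) := by
          refine integral_mono (hhi.sub hg).norm ((hg.sub hpi).norm.add (hbi.mul_const _))
            fun t => ?_
          have : h t - g t = b t • v - (g t - p t) := by simp only [hh]; abel
          simp only [this]
          refine (norm_sub_le _ _).trans ?_
          rw [norm_smul, Real.norm_of_nonneg (hbn t), add_comm]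
      _ = (∫ t, ‖g t - p t‖) + ‖v‖ := by
          have h1 : Integrable fun t => ‖g t - p t‖ := (hg.sub hpi).norm
          rw [integral_add h1 (hbi.mul_const _), integral_mul_const, hb1, one_mul]
      _ ≤ 2 * δ := by linarith
  refine ⟨h, hhc, hhs, fun t => by simp [hh, hp, hv0], ?_, ?_⟩
  · simp only [hh]
    rw [integral_add hpi hbv, integral_smul_const, hb1, one_smul, hv]
    abel
  have hmemg : ∀ t, curve x g t ∈ Metric.closedBall (0 : Fin d → ℝ) (‖x‖ + I + 1) := fun t => by
    rw [mem_closedBall_zero_iff]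
    linarith [norm_curve_le x hg t]
  have hdist : ∀ t, ‖curve x h t - curve x g t‖ ≤ 2 * δ := fun t =>
    (norm_curve_sub_curve_le x hg hhi t).trans hgh
  have hmemh : ∀ t, curve x h t ∈ Metric.closedBall (0 : Fin d → ℝ) (‖x‖ + I + 1) := fun t => by
    rw [mem_closedBall_zero_iff]
    have := norm_le_norm_add_norm_sub' (curve x h t) (curve x g t)
    linarith [norm_curve_le x hg t, hdist t]
  set e : ℝ := ε / (2 * (d * I + 1)) with he
  have hptw : ∀ t, ρ (curve x h t) * √(vnorm2 (h t)) ≤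
      M * d * ‖h t - g t‖ + ρ (curve x g t) * √(vnorm2 (g t)) + e * d * ‖g t‖ := fun t => by
    have h1 : √(vnorm2 (h t)) ≤ √(vnorm2 (h t - g t)) + √(vnorm2 (g t)) := by
      simpa using sqrt_vnorm2_add_le (h t - g t) (g t)
    have h2 := hM _ (hmemh t)
    have h3 : |ρ (curve x h t) - ρ (curve x g t)| ≤ e := by
      rw [← Real.dist_eq]
      refine (huc _ (hmemh t) _ (hmemg t) ?_).le
      rw [dist_eq_norm]
      linarith [hdist t]
    have h4 := sqrt_vnorm2_le (h t - g t)
    have h5 := sqrt_vnorm2_le (g t)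
    calc ρ (curve x h t) * √(vnorm2 (h t))
        ≤ ρ (curve x h t) * √(vnorm2 (h t - g t)) + ρ (curve x h t) * √(vnorm2 (g t)) := by
          rw [← mul_add]
          exact mul_le_mul_of_nonneg_left h1 (hρ0 _)
      _ ≤ M * (d * ‖h t - g t‖) + (ρ (curve x g t) + e) * √(vnorm2 (g t)) := by
          gcongr
          · exact (le_abs_self _).trans h2
          · linarith [(abs_le.1 h3).2]
      _ ≤ _ := by
          have : e * √(vnorm2 (g t)) ≤ e * (d * ‖g t‖) := by gcongr
          linarith
  have hi1 : Integrable fun t => M * d * ‖h t - g t‖ := (hhi.sub hg).norm.const_mul _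
  have hi2 := integrable_speed hρ x hg hg
  have hi3 : Integrable fun t => e * d * ‖g t‖ := hg.norm.const_mul _
  calc curveLen ρ x h
      ≤ ∫ t, (M * d * ‖h t - g t‖ + ρ (curve x g t) * √(vnorm2 (g t)) + e * d * ‖g t‖) :=
        integral_mono (integrable_speed hρ x hhi hhi) ((hi1.add hi2).add hi3) hptw
    _ = M * d * (∫ t, ‖h t - g t‖) + curveLen ρ x g + e * d * I := by
        have hi12 : Integrable fun t =>
            M * d * ‖h t - g t‖ + ρ (curve x g t) * √(vnorm2 (g t)) := hi1.add hi2
        rw [integral_add hi12 hi3, integral_add hi1 hi2, integral_const_mul,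
          integral_const_mul, curveLen]
    _ ≤ M * d * (2 * δ) + curveLen ρ x g + ε / 2 := by
        gcongr
        rw [he, mul_assoc, div_mul_eq_mul_div, div_le_div_iff₀ (by positivity) (by positivity)]
        nlinarith
    _ ≤ curveLen ρ x g + ε := by linarith

lemma exists_radius_of_hasCompactSupport {E : Type*} [Zero E] {h : ℝ → E}
    (hs : HasCompactSupport h) : ∃ R > 0, ∀ t, R ≤ |t| → h t = 0 := by
  obtain ⟨R, hR⟩ := hs.isCompact.isBounded.subset_closedBall 0
  refine ⟨max R 0 + 1, by positivity, fun t ht => ?_⟩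
  by_contra hne
  have := hR (subset_tsupport h hne)
  rw [mem_closedBall_zero_iff, Real.norm_eq_abs] at this
  linarith [le_max_left R 0]

lemma curve_eq_left {d : ℕ} (x : Fin d → ℝ) {h : ℝ → Fin d → ℝ} {R t : ℝ}
    (hR : ∀ t, R ≤ |t| → h t = 0) (ht : t ≤ -R) : curve x h t = x := by
  rw [curve, setIntegral_eq_zero_of_forall_eq_zero, add_zero]
  intro s hs
  exact hR s (by linarith [neg_le_abs s, Set.mem_Iic.1 hs])

lemma curve_eq_right {d : ℕ} (x : Fin d → ℝ) {h : ℝ → Fin d → ℝ} {R t : ℝ}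
    (hR : ∀ t, R ≤ |t| → h t = 0) (ht : R ≤ t) : curve x h t = x + ∫ s, h s := by
  rw [curve, setIntegral_eq_integral_of_forall_compl_eq_zero]
  intro s hs
  exact hR s (by linarith [le_abs_self s, not_le.1 (Set.mem_Iic.not.1 hs)])

lemma geodA_le_curveLen_of_continuous {d : ℕ} [NeZero d] (F : (Fin d → ℝ) → ℝ) {a : ℝ}
    {x : Fin d → ℝ} (hx : x 0 = a) {h : ℝ → Fin d → ℝ} (hc : Continuous h)
    (hs : HasCompactSupport h) (h0 : ∀ t, h t 0 = 0) :
    geodA d F a x (x + ∫ t, h t) ≤ curveLen (fun z => √(2 * F z)) x h := by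
  obtain ⟨R, hRpos, hR⟩ := exists_radius_of_hasCompactSupport hs
  have hi : Integrable h := hc.integrable_of_hasCompactSupport hs
  obtain ⟨C, hC⟩ := hc.bounded_above_of_compact_support hs
  have hder : ∀ t, HasDerivAt (fun t => curve x h (R * t)) (R • h (R * t)) t := fun t => by
    have h1 : HasDerivAt (fun t : ℝ => R * t) R t := by
      simpa using (hasDerivAt_id t).const_mul R
    exact (hasDerivAt_curve x hi hc (R * t)).scomp t h1
  refine csInf_le ⟨0, ?_⟩ ⟨fun t => curve x h (R * t), ⟨(R * C).toNNReal, ?_⟩, fun t => ?_, ?_, ?_, ?_⟩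
  · rintro _ ⟨γ, -, -, -, -, rfl⟩
    exact integral_nonneg fun t => by positivity
  · refine lipschitzWith_of_nnnorm_deriv_le (fun t => (hder t).differentiableAt) fun t => ?_
    rw [(hder t).deriv, ← NNReal.coe_le_coe, coe_nnnorm, norm_smul, Real.norm_of_nonneg hRpos.le]
    exact (mul_le_mul_of_nonneg_left (hC _) hRpos.le).trans (Real.le_coe_toNNReal _)
  · exact (curve_apply_zero x hi h0 _).trans hx
  · exact curve_eq_left x hR (by simp)
  · exact curve_eq_right x hR (by simp)
  · have hd : ∀ t, √(vnorm2 (deriv (fun t => curve x h (R * t)) t)) = R * √(vnorm2 (h (R * t))) :=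
      fun t => by rw [(hder t).deriv, sqrt_vnorm2_smul, abs_of_pos hRpos]
    simp_rw [hd]
    rw [integral_Icc_eq_integral_Ioc, ← intervalIntegral.integral_of_le (by norm_num)]
    calc curveLen (fun z => √(2 * F z)) x h
        = ∫ t in (-R)..R, √(2 * F (curve x h t)) * √(vnorm2 (h t)) := by
          rw [intervalIntegral.integral_of_le (by linarith),
            setIntegral_eq_integral_of_forall_compl_eq_zero]
          · rfl
          · intro t ht
            rw [hR t, sqrt_vnorm2_zero, mul_zero]
            by_contra! hlt
            exact ht ⟨(abs_lt.1 hlt).1, (abs_lt.1 hlt).2.le⟩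
      _ = R * ∫ t in (-1 : ℝ)..1, √(2 * F (curve x h (R * t))) * √(vnorm2 (h (R * t))) := by
          rw [intervalIntegral.mul_integral_comp_mul_left
            (f := fun t => √(2 * F (curve x h t)) * √(vnorm2 (h t)))]
          simp
      _ = _ := by
          rw [← intervalIntegral.integral_const_mul]
          congr 1
          ext t
          ring

/-- A smooth curve between two wells can be reparametrized over `ℝ` so that its energy is almost
its length. -/
lemma exists_adm1D_energy1D_le {d : ℕ} [NeZero d] {W : (Fin d → ℝ) → ℝ} (hWc : Continuous W)
    (hWnn : ∀ z, 0 ≤ W z) {a : ℝ} {x y : Fin d → ℝ} (hx : x ∈ wellSet d W a)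
    (hy : y ∈ wellSet d W a) {h : ℝ → Fin d → ℝ} (hc : Continuous h)
    (hs : HasCompactSupport h) (h0 : ∀ t, h t 0 = 0) (hxy : x + ∫ t, h t = y)
    {ε : ℝ} (hε : 0 < ε) :
    ∃ γ, Adm1D d a x y γ ∧
      energy1D d W γ ≤ ENNReal.ofReal (curveLen (fun z => √(2 * W z)) x h + ε) := by
  obtain ⟨R, hRpos, hR⟩ := exists_radius_of_hasCompactSupport hs
  have hi : Integrable h := hc.integrable_of_hasCompactSupport hs
  set η : ℝ → Fin d → ℝ := curve x h with hη
  have hηc : Continuous η := continuous_curve x hi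
  have hηl : ∀ t ≤ -R, η t = x := fun t ht => curve_eq_left x hR ht
  have hηr : ∀ t ≥ R, η t = y := fun t ht => hxy ▸ curve_eq_right x hR ht
  set w : ℝ → ℝ := fun t => √(2 * W (η t)) with hw
  set N : ℝ → ℝ := fun t => √(vnorm2 (h t)) with hN
  have hwc : Continuous w := by fun_prop
  have hNc : Continuous N := (continuous_vnorm2.comp hc).sqrt
  have hw0 : ∀ t, 0 ≤ w t := fun t => Real.sqrt_nonneg _
  have hN0 : ∀ t, 0 ≤ N t := fun t => Real.sqrt_nonneg _
  have hwR : ∀ t, R ≤ |t| → w t = 0 := fun t ht => by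
    rcases le_abs'.1 ht with ht | ht
    · simp [hw, hηl t ht, hx.2]
    · simp [hw, hηr t ht, hy.2]
  have hws : HasCompactSupport w := HasCompactSupport.intro (isCompact_Icc (a := -R) (b := R))
    fun t ht => hwR t (by
      by_contra! hlt
      exact ht ⟨(abs_lt.1 hlt).1.le, (abs_lt.1 hlt).2.le⟩)
  have hwi : Integrable w := hwc.integrable_of_hasCompactSupport hws
  have hNi : Integrable N := integrable_sqrt_vnorm2 hi
  obtain ⟨M, hM⟩ := hwc.bounded_above_of_compact_support hws
  have hM0 : 0 ≤ M := (norm_nonneg _).trans (hM 0)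
  have hIN : 0 ≤ ∫ t, N t := integral_nonneg hN0
  have hIw : 0 ≤ ∫ t, w t := integral_nonneg hw0
  set δ : ℝ := ε / ((∫ t, N t) + 1) with hδ
  set κ : ℝ := ε / ((∫ t, w t) + 1) with hκ
  have hδpos : 0 < δ := by positivity
  have hκpos : 0 < κ := by positivity
  set s : ℝ → ℝ := fun t => (N t + κ) / (w t + δ) with hs_def
  have hsc : Continuous s :=
    (hNc.add continuous_const).div (hwc.add continuous_const) fun t => by
      have := hw0 t
      positivity
  have hslow : ∀ t, κ / (M + δ) ≤ s t := fun t => by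
    have h1 := hM t
    rw [Real.norm_of_nonneg (hw0 t)] at h1
    have := hw0 t
    exact div_le_div₀ (by linarith [hN0 t]) (by linarith [hN0 t]) (by positivity) (by linarith)
  have hclow : 0 < κ / (M + δ) := by positivity
  have hspos : ∀ t, 0 < s t := fun t => hclow.trans_le (hslow t)
  set σ : ℝ → ℝ := fun t => ∫ r in (0 : ℝ)..t, s r with hσ
  have hσd : ∀ t, HasDerivAt σ (s t) t := fun t => hsc.integral_hasStrictDerivAt 0 t |>.hasDerivAt
  have hσc : Continuous σ := continuous_iff_continuousAt.2 fun t => (hσd t).continuousAt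
  have hσm : StrictMono σ := strictMono_of_deriv_pos fun t => by rw [(hσd t).deriv]; exact hspos t
  have hgrow : ∀ ⦃p q : ℝ⦄, p ≤ q → κ / (M + δ) * (q - p) ≤ σ q - σ p :=
    mul_sub_le_image_sub_of_le_deriv (fun t => (hσd t).differentiableAt) fun t => by
      rw [(hσd t).deriv]; exact hslow t
  have hσ0 : σ 0 = 0 := by simp [hσ]
  have hσsurj : Function.Surjective σ := by
    refine hσc.surjective ?_ ?_
    · refine tendsto_atTop_mono' _ ?_ (tendsto_id.const_mul_atTop hclow)
      filter_upwards [eventually_ge_atTop 0] with t ht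
      simpa [hσ0] using hgrow ht
    · refine tendsto_atBot_mono' _ ?_ (tendsto_id.const_mul_atBot hclow)
      filter_upwards [eventually_le_atBot 0] with t ht
      have := hgrow ht
      simp only [hσ0, id] at this ⊢
      linarith
  set e : ℝ ≃o ℝ := hσm.orderIsoOfSurjective σ hσsurj with he
  have heσ : ∀ t, e.symm (σ t) = t := fun t => e.symm_apply_apply t
  have hσe : ∀ r, σ (e.symm r) = r := fun r => e.apply_symm_apply r
  have hed : ∀ r, HasDerivAt e.symm (s (e.symm r))⁻¹ r := fun r =>
    HasDerivAt.of_local_left_inverse e.symm.continuous.continuousAt (hσd _) (hspos _).ne'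
      (Eventually.of_forall hσe)
  set γ : ℝ → Fin d → ℝ := fun r => η (e.symm r) with hγ
  have hγd : ∀ r, HasDerivAt γ ((s (e.symm r))⁻¹ • h (e.symm r)) r := fun r =>
    (hasDerivAt_curve x hi hc _).scomp r (hed r)
  refine ⟨γ, ⟨fun r => (hγd r).differentiableAt, fun r => ?_, ?_, ?_⟩, ?_⟩
  · exact (curve_apply_zero x hi h0 _).trans hx.1
  · refine tendsto_const_nhds.congr' ?_
    filter_upwards [e.symm.tendsto_atBot (eventually_le_atBot (-R))] with r hr using (hηl _ hr).symm
  · refine tendsto_const_nhds.congr' ?_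
    filter_upwards [e.symm.tendsto_atTop (eventually_ge_atTop R)] with r hr using (hηr _ hr).symm
  have hptw : ∀ t, s t * ((1 / 2) * vnorm2 (deriv γ (σ t)) + W (γ (σ t))) ≤
      w t * N t + (δ / 2 * N t + κ / 2 * w t) := fun t => by
    have h1 : vnorm2 (deriv γ (σ t)) = ((s t)⁻¹ * N t) ^ 2 := by
      rw [(hγd _).deriv, heσ, ← Real.sq_sqrt (vnorm2_nonneg _), sqrt_vnorm2_smul,
        abs_of_pos (inv_pos.2 (hspos t))]
    have h2 : W (γ (σ t)) = w t ^ 2 / 2 := by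
      rw [hγ, hw, Real.sq_sqrt (by linarith [hWnn (η t)])]
      simp only [heσ]
      ring
    have hNt := hN0 t
    have hwt := hw0 t
    have h3 : s t * (s t)⁻¹ = 1 := mul_inv_cancel₀ (hspos t).ne'
    have h4 : (s t)⁻¹ * N t ≤ w t + δ := by
      rw [hs_def, inv_div, div_mul_eq_mul_div, div_le_iff₀ (by positivity)]
      nlinarith
    have h5 : s t * w t ≤ N t + κ := by
      rw [hs_def, div_mul_eq_mul_div, div_le_iff₀ (by positivity)]
      nlinarith
    rw [h1, h2]
    calc s t * (1 / 2 * ((s t)⁻¹ * N t) ^ 2 + w t ^ 2 / 2)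
        = 1 / 2 * N t * ((s t)⁻¹ * N t) * (s t * (s t)⁻¹) + 1 / 2 * w t * (s t * w t) := by ring
      _ ≤ 1 / 2 * N t * (w t + δ) * 1 + 1 / 2 * w t * (N t + κ) := by
          rw [h3]
          gcongr
      _ = _ := by ring
  have hiL : Integrable fun t => w t * N t := by
    have hρ : Continuous fun z => √(2 * W z) := by fun_prop
    exact integrable_speed hρ x hi hi
  have hiδ : Integrable fun t => δ / 2 * N t := hNi.const_mul _
  have hiκ : Integrable fun t => κ / 2 * w t := hwi.const_mul _
  have hiδκ : Integrable fun t => δ / 2 * N t + κ / 2 * w t := hiδ.add hiκ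
  calc energy1D d W γ
      = ∫⁻ r in σ '' Set.univ, ENNReal.ofReal ((1 / 2) * vnorm2 (deriv γ r) + W (γ r)) := by
        rw [Set.image_univ, hσsurj.range_eq, Measure.restrict_univ, energy1D]
    _ = ∫⁻ t, ENNReal.ofReal |s t| *
          ENNReal.ofReal ((1 / 2) * vnorm2 (deriv γ (σ t)) + W (γ (σ t))) := by
        rw [lintegral_image_eq_lintegral_abs_deriv_mul MeasurableSet.univ
          (fun t _ => (hσd t).hasDerivWithinAt) hσm.injective.injOn, Measure.restrict_univ]
    _ ≤ ∫⁻ t, ENNReal.ofReal (w t * N t + (δ / 2 * N t + κ / 2 * w t)) := by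
        refine lintegral_mono fun t => ?_
        rw [abs_of_pos (hspos t), ← ENNReal.ofReal_mul (hspos t).le]
        exact ENNReal.ofReal_le_ofReal (hptw t)
    _ = ENNReal.ofReal (∫ t, (w t * N t + (δ / 2 * N t + κ / 2 * w t))) := by
        refine (ofReal_integral_eq_lintegral_ofReal (hiL.add hiδκ) (ae_of_all _ fun t => ?_)).symm
        have := hw0 t
        have := hN0 t
        simp only [Pi.add_apply, Pi.zero_apply]
        positivity
    _ ≤ _ := by
        refine ENNReal.ofReal_le_ofReal ?_
        rw [integral_add hiL hiδκ, integral_add hiδ hiκ, integral_const_mul, integral_const_mul]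
        have h1 : δ / 2 * ∫ t, N t ≤ ε / 2 := by
          rw [hδ, div_div, div_mul_eq_mul_div, div_le_div_iff₀ (by positivity) (by positivity)]
          nlinarith
        have h2 : κ / 2 * ∫ t, w t ≤ ε / 2 := by
          rw [hκ, div_div, div_mul_eq_mul_div, div_le_div_iff₀ (by positivity) (by positivity)]
          nlinarith
        change (∫ t, w t * N t) + _ ≤ (∫ t, w t * N t) + ε
        linarith

lemma geodA_le_curveLen {d : ℕ} [NeZero d] {F : (Fin d → ℝ) → ℝ} (hF : Continuous F) {a : ℝ}
    {x y : Fin d → ℝ} (hx : x 0 = a) {g : ℝ → Fin d → ℝ} (hg : Integrable g)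
    (hg0 : ∀ t, g t 0 = 0) (hxy : x + ∫ t, g t = y) :
    geodA d F a x y ≤ curveLen (fun z => √(2 * F z)) x g := by
  refine le_of_forall_pos_le_add fun ε hε => ?_
  obtain ⟨h, hc, hs, h0, hint, hle⟩ := exists_smooth_curve
    (ρ := fun z => √(2 * F z)) (by fun_prop) (fun _ => Real.sqrt_nonneg _) x hg hg0 hε
  rw [← hxy, ← hint]
  exact (geodA_le_curveLen_of_continuous F hx hc hs h0).trans hle

lemma setIntegral_Iic_indicator_Ioc {E : Type*} [NormedAddCommGroup E] [NormedSpace ℝ E]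
    (f : ℝ → E) (p q t : ℝ) :
    ∫ s in Set.Iic t, (Set.Ioc p q).indicator f s = ∫ s in p..max p (min t q), f s := by
  rw [setIntegral_indicator measurableSet_Ioc, intervalIntegral.integral_of_le (le_max_left _ _)]
  congr 2
  ext s
  simp only [Set.mem_inter_iff, Set.mem_Iic, Set.mem_Ioc, le_max_iff, le_min_iff]
  constructor
  · rintro ⟨h1, h2, h3⟩
    exact ⟨h2, Or.inr ⟨h1, h3⟩⟩
  · rintro ⟨h1, h2 | h2⟩
    · exact absurd h1 h2.not_gt
    · exact ⟨h2.1, h1, h2.2⟩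

lemma integral_indicator_Ioc {E : Type*} [NormedAddCommGroup E] [NormedSpace ℝ E]
    (f : ℝ → E) {p q : ℝ} (hpq : p ≤ q) :
    ∫ s, (Set.Ioc p q).indicator f s = ∫ s in p..q, f s := by
  rw [integral_indicator measurableSet_Ioc, intervalIntegral.integral_of_le hpq]

lemma deriv_apply_eq_zero {d : ℕ} [NeZero d] {γ : ℝ → Fin d → ℝ} {a : ℝ} (h : ∀ t, γ t 0 = a)
    (t : ℝ) : deriv γ t 0 = 0 := by
  by_cases hd : DifferentiableAt ℝ γ t
  · have h1 : HasDerivAt (fun s => γ s 0) (deriv γ t 0) t := hasDerivAt_pi.1 hd.hasDerivAt 0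
    simp only [h] at h1
    exact h1.unique (hasDerivAt_const t a)
  · simp [deriv_zero_of_not_differentiableAt hd]

lemma LipschitzWith.integrableOn_deriv_Ioc {d : ℕ} {K : NNReal} {β : ℝ → Fin d → ℝ}
    (hβ : LipschitzWith K β) (p q : ℝ) : IntegrableOn (deriv β) (Set.Ioc p q) :=
  Measure.integrableOn_of_bounded (M := K) (by simp) (measurable_deriv β).aestronglyMeasurable
    (ae_of_all _ fun _ => norm_deriv_le_of_lipschitz hβ)

lemma LipschitzWith.integral_deriv_eq_sub {d : ℕ} {K : NNReal} {β : ℝ → Fin d → ℝ}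
    (hβ : LipschitzWith K β) {p q : ℝ} (hpq : p ≤ q) :
    ∫ t in p..q, deriv β t = β q - β p := by
  have hint := hβ.integrableOn_deriv_Ioc p q
  ext i
  have hi : LipschitzWith (1 * K) fun t => β t i := (LipschitzWith.eval i).comp hβ
  have h1 : ∫ t in p..q, deriv (fun t => β t i) t = β q i - β p i :=
    (hi.lipschitzOnWith (s := Set.uIcc p q)).absolutelyContinuousOnInterval.integral_deriv_eq_sub
  rw [intervalIntegral.integral_of_le hpq, eval_integral fun i => hint.eval i, Pi.sub_apply, ← h1,
    intervalIntegral.integral_of_le hpq]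
  refine integral_congr_ae (ae_restrict_of_ae ?_)
  filter_upwards [hβ.ae_differentiableAt_real] with t ht
  exact (hasDerivAt_pi.1 ht.hasDerivAt i).deriv.symm

/-- The weighted length of a Lipschitz curve over `[-1, 1]` is that of an integrable velocity. -/
lemma exists_integrable_of_lipschitz {d : ℕ} [NeZero d] (ρ : (Fin d → ℝ) → ℝ) {a : ℝ}
    {K : NNReal} {β : ℝ → Fin d → ℝ} (hβ : LipschitzWith K β) (h0 : ∀ t, β t 0 = a) :
    ∃ g : ℝ → Fin d → ℝ, Integrable g ∧ (∀ t, g t 0 = 0) ∧ β (-1) + ∫ t, g t = β 1 ∧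
      curveLen ρ (β (-1)) g =
        ∫ t in Set.Icc (-1 : ℝ) 1, ρ (β t) * √(vnorm2 (deriv β t)) := by
  refine ⟨(Set.Ioc (-1 : ℝ) 1).indicator (deriv β),
    (hβ.integrableOn_deriv_Ioc (-1) 1).integrable_indicator measurableSet_Ioc, fun t => ?_, ?_, ?_⟩
  · by_cases ht : t ∈ Set.Ioc (-1 : ℝ) 1
    · simp [Set.indicator_of_mem ht, deriv_apply_eq_zero h0]
    · simp [Set.indicator_of_notMem ht]
  · rw [integral_indicator_Ioc _ (by norm_num), hβ.integral_deriv_eq_sub (by norm_num)]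
    abel
  · rw [integral_Icc_eq_integral_Ioc, ← integral_indicator measurableSet_Ioc, curveLen]
    congr 1
    ext t
    by_cases ht : t ∈ Set.Ioc (-1 : ℝ) 1
    · rw [Set.indicator_of_mem ht, Set.indicator_of_mem ht, curve,
        setIntegral_Iic_indicator_Ioc, min_eq_left ht.2, max_eq_right ht.1.le,
        hβ.integral_deriv_eq_sub ht.1.le, add_sub_cancel]
    · rw [Set.indicator_of_notMem ht, Set.indicator_of_notMem ht, sqrt_vnorm2_zero, mul_zero]

/-- Closing up a connecting curve by two short segments near the wells. -/
lemma exists_geodA_le_add {d : ℕ} [NeZero d] {W : (Fin d → ℝ) → ℝ} (hWc : Continuous W)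
    {a : ℝ} {x y : Fin d → ℝ} (hx : x ∈ wellSet d W a)
    (hy : y ∈ wellSet d W a) {γ : ℝ → Fin d → ℝ} (hγ : Adm1D d a x y γ)
    (hint : ∀ p q, IntegrableOn (deriv γ) (Set.Ioc p q)) {ε : ℝ} (hε : 0 < ε) :
    ∃ T > 0, geodA d W a x y ≤
      (∫ t in Set.Ioc (-T) T, √(2 * W (γ t)) * √(vnorm2 (deriv γ t))) + ε := by
  obtain ⟨hγd, hγ0, hγm, hγp⟩ := hγ
  have hρ : Continuous fun z => √(2 * W z) := by fun_prop
  have hev : ∀ z ∈ wellSet d W a, ∃ r > 0, ∀ v, ‖v - z‖ < r → √(2 * W v) ≤ 1 := by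
    intro z hz
    have : ∀ᶠ v in 𝓝 z, √(2 * W v) < 1 :=
      hρ.continuousAt.eventually_lt continuousAt_const (by simp [hz.2])
    obtain ⟨r, hr, hb⟩ := Metric.eventually_nhds_iff.1 this
    exact ⟨r, hr, fun v hv => (hb (by rwa [dist_eq_norm])).le⟩
  obtain ⟨r₁, hr₁, hb₁⟩ := hev x hx
  obtain ⟨r₂, hr₂, hb₂⟩ := hev y hy
  set r : ℝ := min (min r₁ r₂) (ε / (2 * (d + 1))) with hr
  have hrpos : 0 < r := by positivity
  have hrε : d * r ≤ ε / 2 := by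
    have h1 : r ≤ ε / (2 * (d + 1)) := min_le_right _ _
    rw [le_div_iff₀ (by positivity)] at h1
    nlinarith
  have hm : ∀ᶠ T in atTop, ‖γ (-T) - x‖ < r := by
    have := (hγm.comp tendsto_neg_atTop_atBot).eventually (Metric.ball_mem_nhds x hrpos)
    filter_upwards [this] with T hT
    simpa [dist_eq_norm] using hT
  have hp : ∀ᶠ T in atTop, ‖γ T - y‖ < r := by
    filter_upwards [hγp.eventually (Metric.ball_mem_nhds y hrpos)] with T hT
    simpa [dist_eq_norm] using hT
  obtain ⟨T, hTpos, hTm, hTp⟩ := ((eventually_gt_atTop 0).and (hm.and hp)).exists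
  refine ⟨T, hTpos, ?_⟩
  set v := γ (-T) - x with hv
  set w := y - γ T with hw
  set I₁ := Set.Ioc (-T - 1) (-T) with hI₁
  set I₂ := Set.Ioc (-T) T with hI₂
  set I₃ := Set.Ioc T (T + 1) with hI₃
  set g : ℝ → Fin d → ℝ := fun t =>
    I₁.indicator (fun _ => v) t + I₂.indicator (deriv γ) t + I₃.indicator (fun _ => w) t with hg
  have hi₁ : Integrable (I₁.indicator fun _ => v) :=
    (integrableOn_const (by simp [hI₁])).integrable_indicator measurableSet_Ioc
  have hi₂ : Integrable (I₂.indicator (deriv γ)) := (hint _ _).integrable_indicator measurableSet_Ioc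
  have hi₃ : Integrable (I₃.indicator fun _ => w) :=
    (integrableOn_const (by simp [hI₃])).integrable_indicator measurableSet_Ioc
  have hi₁₂ : Integrable fun t => I₁.indicator (fun _ => v) t + I₂.indicator (deriv γ) t :=
    hi₁.add hi₂
  have hgi : Integrable g := hi₁₂.add hi₃
  have hftc : ∀ {p q}, p ≤ q → ∫ t in p..q, deriv γ t = γ q - γ p := fun {p q} hpq =>
    intervalIntegral.integral_deriv_eq_sub (fun t _ => hγd t)
      ((intervalIntegrable_iff_integrableOn_Ioc_of_le hpq).2 (hint _ _))
  have hv0 : v 0 = 0 := by simp [hv, hγ0, hx.1]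
  have hw0 : w 0 = 0 := by simp [hw, hγ0, hy.1]
  have hg0 : ∀ t, g t 0 = 0 := fun t => by
    have := deriv_apply_eq_zero hγ0 t
    simp only [hg, Pi.add_apply, Set.indicator]
    split_ifs <;> simp [hv0, hw0, this]
  have hle₁ : -T - 1 ≤ -T := by linarith
  have hle₂ : -T ≤ T := by linarith
  have hle₃ : T ≤ T + 1 := by linarith
  have hend : x + ∫ t, g t = y := by
    rw [integral_add hi₁₂ hi₃, integral_add hi₁ hi₂, integral_indicator_Ioc _ hle₁,
      integral_indicator_Ioc _ hle₂, integral_indicator_Ioc _ hle₃, hftc hle₂]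
    simp [hv, hw]
  have hcurve : ∀ t, curve x g t = x + ((max (-T - 1) (min t (-T)) - (-T - 1)) • v +
      (γ (max (-T) (min t T)) - γ (-T)) + (max T (min t (T + 1)) - T) • w) := fun t => by
    rw [curve, integral_add hi₁₂.integrableOn hi₃.integrableOn,
      integral_add hi₁.integrableOn hi₂.integrableOn, setIntegral_Iic_indicator_Ioc,
      setIntegral_Iic_indicator_Ioc, setIntegral_Iic_indicator_Ioc,
      hftc (le_max_left _ _)]
    simp
  refine (geodA_le_curveLen hWc hx.1 hgi hg0 hend).trans ?_
  have hptw : ∀ t, √(2 * W (curve x g t)) * √(vnorm2 (g t)) ≤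
      I₁.indicator (fun _ => d * r) t +
      I₂.indicator (fun t => √(2 * W (γ t)) * √(vnorm2 (deriv γ t))) t +
      I₃.indicator (fun _ => d * r) t := by
    intro t
    have hshort : ∀ u : Fin d → ℝ, ‖u‖ < r → √(vnorm2 u) ≤ d * r := fun u hu =>
      (sqrt_vnorm2_le u).trans (by gcongr)
    by_cases h1 : t ∈ I₁
    · have h2 : t ∉ I₂ := fun h => by linarith [h.1, h1.2]
      have h3 : t ∉ I₃ := fun h => by linarith [h.1, h1.2]
      have hgt : g t = v := by simp [hg, h1, h2, h3]
      have hct : curve x g t - x = (t + T + 1) • v := by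
        rw [hcurve, min_eq_left h1.2, max_eq_right h1.1.le, min_eq_left (by linarith [h1.2]),
          max_eq_left h1.2, min_eq_left (by linarith [h1.2]), max_eq_left (by linarith [h1.2])]
        simp only [sub_self, zero_smul, add_zero, add_sub_cancel_left]
        congr 1
        ring
      have hnorm : ‖curve x g t - x‖ < r₁ := by
        rw [hct, norm_smul, Real.norm_of_nonneg (by linarith [h1.1])]
        have hrr : r ≤ r₁ := (min_le_left _ _).trans (min_le_left _ _)
        have : (t + T + 1) * ‖v‖ ≤ 1 * ‖v‖ := by gcongr; linarith [h1.2]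
        linarith
      simp only [h1, h2, h3, Set.indicator_of_mem, not_false_eq_true, Set.indicator_of_notMem,
        add_zero, hgt]
      calc _ ≤ 1 * (d * r) := mul_le_mul (hb₁ _ hnorm) (hshort v hTm) (Real.sqrt_nonneg _)
              zero_le_one
        _ = _ := one_mul _
    by_cases h2 : t ∈ I₂
    · have h3 : t ∉ I₃ := fun h => by linarith [h.1, h2.2]
      have hgt : g t = deriv γ t := by simp [hg, h1, h2, h3]
      have hct : curve x g t = γ t := by
        rw [hcurve, min_eq_right h2.1.le, max_eq_right hle₁, min_eq_left h2.2,
          max_eq_right h2.1.le, min_eq_left (by linarith [h2.2]), max_eq_left h2.2]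
        simp [hv]
      simp [h1, h2, h3, hgt, hct]
    by_cases h3 : t ∈ I₃
    · have hgt : g t = w := by simp [hg, h1, h2, h3]
      have hct : curve x g t - y = -((T + 1 - t) • w) := by
        rw [hcurve, min_eq_right (by linarith [h3.1]), max_eq_right hle₁,
          min_eq_right h3.1.le, max_eq_right hle₂, min_eq_left h3.2, max_eq_right h3.1.le]
        ext i
        simp [hv, hw]
        ring
      have hnw : ‖w‖ < r := by rwa [hw, norm_sub_rev]
      have hnorm : ‖curve x g t - y‖ < r₂ := by
        rw [hct, norm_neg, norm_smul, Real.norm_of_nonneg (by linarith [h3.2])]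
        have hrr : r ≤ r₂ := (min_le_left _ _).trans (min_le_right _ _)
        have : (T + 1 - t) * ‖w‖ ≤ 1 * ‖w‖ := by gcongr; linarith [h3.1]
        linarith
      simp only [h1, h2, h3, Set.indicator_of_mem, not_false_eq_true, Set.indicator_of_notMem,
        zero_add, hgt]
      calc _ ≤ 1 * (d * r) := mul_le_mul (hb₂ _ hnorm) (hshort w hnw) (Real.sqrt_nonneg _)
              zero_le_one
        _ = _ := one_mul _
    · have hgt : g t = 0 := by simp [hg, h1, h2, h3]
      simp [h1, h2, h3, hgt, sqrt_vnorm2_zero]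
  have hj₁ : Integrable (I₁.indicator fun _ => d * r) :=
    (integrableOn_const (by simp [hI₁])).integrable_indicator measurableSet_Ioc
  have hj₃ : Integrable (I₃.indicator fun _ => d * r) :=
    (integrableOn_const (by simp [hI₃])).integrable_indicator measurableSet_Ioc
  have hj₂ : Integrable (I₂.indicator fun t => √(2 * W (γ t)) * √(vnorm2 (deriv γ t))) := by
    obtain ⟨M, hM⟩ := (isCompact_Icc (a := -T) (b := T)).exists_bound_of_continuousOn
      (hρ.comp hγd.continuous).continuousOn
    refine IntegrableOn.integrable_indicator ?_ measurableSet_Ioc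
    have hN := (integrable_sqrt_vnorm2 hi₂).integrableOn (s := I₂)
    have hN' : IntegrableOn (fun t => √(vnorm2 (deriv γ t))) I₂ :=
      hN.congr_fun (fun t ht => by simp [Set.indicator_of_mem ht]) measurableSet_Ioc
    refine hN'.bdd_mul (c := M) (hρ.comp hγd.continuous).aestronglyMeasurable ?_
    filter_upwards [ae_restrict_mem measurableSet_Ioc] with t ht
    exact hM t ⟨ht.1.le, ht.2⟩
  have hj₁₂ : Integrable fun t => I₁.indicator (fun _ => d * r) t +
      I₂.indicator (fun t => √(2 * W (γ t)) * √(vnorm2 (deriv γ t))) t := hj₁.add hj₂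
  calc curveLen (fun z => √(2 * W z)) x g ≤ _ :=
        integral_mono (integrable_speed hρ x hgi hgi) (hj₁₂.add hj₃) hptw
    _ = d * r + (∫ t in I₂, √(2 * W (γ t)) * √(vnorm2 (deriv γ t))) + d * r := by
        simp only [Pi.add_apply]
        rw [integral_add hj₁₂ hj₃, integral_add hj₁ hj₂, integral_indicator measurableSet_Ioc,
          integral_indicator measurableSet_Ioc, integral_indicator measurableSet_Ioc]
        simp [hI₂]
    _ ≤ _ := by linarith

lemma sqrt_mul_sqrt_vnorm2_le {d : ℕ} {c : ℝ} (hc : 0 ≤ c) (v : Fin d → ℝ) :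
    √(2 * c) * √(vnorm2 v) ≤ (1 / 2) * vnorm2 v + c := by
  have h1 := Real.sq_sqrt (vnorm2_nonneg v)
  have h2 := Real.sq_sqrt (show 0 ≤ 2 * c by linarith)
  nlinarith [sq_nonneg (√(2 * c) - √(vnorm2 v))]

lemma vnorm2_eq_of_sqrt_mul_sqrt_eq {d : ℕ} {c : ℝ} (hc : 0 ≤ c) {v : Fin d → ℝ}
    (h : √(2 * c) * √(vnorm2 v) = (1 / 2) * vnorm2 v + c) : vnorm2 v = 2 * c := by
  have h1 := Real.sq_sqrt (vnorm2_nonneg v)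
  have h2 := Real.sq_sqrt (show 0 ≤ 2 * c by linarith)
  have h3 : (√(2 * c) - √(vnorm2 v)) ^ 2 = 0 := by nlinarith
  have h4 : √(2 * c) = √(vnorm2 v) := sub_eq_zero.1 (pow_eq_zero_iff two_ne_zero |>.1 h3)
  rw [← h1, ← h4, h2]

lemma integrableOn_deriv_of_energy1D_ne_top {d : ℕ} {W : (Fin d → ℝ) → ℝ}
    (hWnn : ∀ z, 0 ≤ W z) {γ : ℝ → Fin d → ℝ} (hE : energy1D d W γ ≠ ⊤) (p q : ℝ) :
    IntegrableOn (deriv γ) (Set.Ioc p q) := by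
  refine ⟨(measurable_deriv γ).aestronglyMeasurable, ?_⟩
  have hptw : ∀ t, ‖deriv γ t‖ₑ ≤
      1 + ENNReal.ofReal ((1 / 2) * vnorm2 (deriv γ t) + W (γ t)) := fun t => by
    rw [← ofReal_norm, ← ENNReal.ofReal_one, ← ENNReal.ofReal_add zero_le_one
      (by have := vnorm2_nonneg (deriv γ t); have := hWnn (γ t); positivity)]
    refine ENNReal.ofReal_le_ofReal ?_
    have h1 := norm_le_sqrt_vnorm2 (deriv γ t)
    have h2 := Real.sq_sqrt (vnorm2_nonneg (deriv γ t))
    nlinarith [sq_nonneg (√(vnorm2 (deriv γ t)) - 1), hWnn (γ t)]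
  calc ∫⁻ t in Set.Ioc p q, ‖deriv γ t‖ₑ
      ≤ ∫⁻ t in Set.Ioc p q, (1 + ENNReal.ofReal ((1 / 2) * vnorm2 (deriv γ t) + W (γ t))) :=
        lintegral_mono hptw
    _ = volume (Set.Ioc p q) +
          ∫⁻ t in Set.Ioc p q, ENNReal.ofReal ((1 / 2) * vnorm2 (deriv γ t) + W (γ t)) := by
        rw [lintegral_add_left measurable_const, setLIntegral_one]
    _ ≤ volume (Set.Ioc p q) + energy1D d W γ := by
        gcongr
        exact setLIntegral_le_lintegral _ _
    _ < ⊤ := ENNReal.add_lt_top.2 ⟨by simp, hE.lt_top⟩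

/-- The weighted length of a finite energy connection is at least the geodesic distance. -/
lemma geodA_le_lintegral_length {d : ℕ} [NeZero d] {W : (Fin d → ℝ) → ℝ} (hWc : Continuous W)
    (hWnn : ∀ z, 0 ≤ W z) {a : ℝ} {x y : Fin d → ℝ} (hx : x ∈ wellSet d W a)
    (hy : y ∈ wellSet d W a) {γ : ℝ → Fin d → ℝ} (hγ : Adm1D d a x y γ)
    (hE : energy1D d W γ ≠ ⊤) :
    ENNReal.ofReal (geodA d W a x y) ≤
      ∫⁻ t, ENNReal.ofReal (√(2 * W (γ t)) * √(vnorm2 (deriv γ t))) := by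
  have hint := integrableOn_deriv_of_energy1D_ne_top hWnn hE
  have hmeas : Measurable fun t => √(2 * W (γ t)) * √(vnorm2 (deriv γ t)) :=
    ((continuous_const.mul (hWc.comp hγ.1.continuous)).sqrt.measurable).mul
      (continuous_vnorm2.sqrt.measurable.comp (measurable_deriv γ))
  refine ENNReal.le_of_forall_pos_le_add fun ε hε _ => ?_
  obtain ⟨T, -, hle⟩ := exists_geodA_le_add hWc hx hy hγ hint (NNReal.coe_pos.2 hε)
  have h0 : 0 ≤ ∫ t in Set.Ioc (-T) T, √(2 * W (γ t)) * √(vnorm2 (deriv γ t)) :=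
    integral_nonneg fun t => by positivity
  calc ENNReal.ofReal (geodA d W a x y)
      ≤ ENNReal.ofReal (∫ t in Set.Ioc (-T) T, √(2 * W (γ t)) * √(vnorm2 (deriv γ t))) + ε := by
        refine (ENNReal.ofReal_le_ofReal hle).trans_eq ?_
        rw [ENNReal.ofReal_add h0 ε.coe_nonneg, ENNReal.ofReal_coe_nnreal]
    _ ≤ _ := by
        gcongr
        rw [integral_eq_lintegral_of_nonneg_ae (ae_of_all _ fun t => by positivity)
          hmeas.aestronglyMeasurable]
        exact ENNReal.ofReal_toReal_le.trans (setLIntegral_le_lintegral _ _)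

lemma lintegral_length_le_energy1D {d : ℕ} {W : (Fin d → ℝ) → ℝ}
    (hWnn : ∀ z, 0 ≤ W z) (γ : ℝ → Fin d → ℝ) :
    ∫⁻ t, ENNReal.ofReal (√(2 * W (γ t)) * √(vnorm2 (deriv γ t))) ≤ energy1D d W γ :=
  lintegral_mono fun _ => ENNReal.ofReal_le_ofReal (sqrt_mul_sqrt_vnorm2_le (hWnn _) _)

lemma exists_lipschitz_segment {d : ℕ} [NeZero d] {a : ℝ} {x y : Fin d → ℝ} (hx : x 0 = a)
    (hy : y 0 = a) : ∃ γ : ℝ → Fin d → ℝ, (∃ K : NNReal, LipschitzWith K γ) ∧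
      (∀ t, γ t 0 = a) ∧ γ (-1) = x ∧ γ 1 = y := by
  have hder : ∀ t, HasDerivAt (fun t : ℝ => x + ((t + 1) / 2) • (y - x))
      ((1 / 2 : ℝ) • (y - x)) t := fun t =>
    ((((hasDerivAt_id t).add_const 1).div_const 2).smul_const (y - x)).const_add x
  refine ⟨fun t => x + ((t + 1) / 2) • (y - x), ⟨‖(1 / 2 : ℝ) • (y - x)‖₊,
    lipschitzWith_of_nnnorm_deriv_le (fun t => (hder t).differentiableAt) fun t => ?_⟩,
    fun t => ?_, ?_, ?_⟩
  · rw [(hder t).deriv]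
  · simp [hx, hy]
  · simp
  · norm_num

lemma iInf_energy1D_le_geodA {d : ℕ} [NeZero d] {W : (Fin d → ℝ) → ℝ} (hWc : Continuous W)
    (hWnn : ∀ z, 0 ≤ W z) {a : ℝ} {x y : Fin d → ℝ} (hx : x ∈ wellSet d W a)
    (hy : y ∈ wellSet d W a) :
    ⨅ (γ : ℝ → Fin d → ℝ) (_ : Adm1D d a x y γ), energy1D d W γ ≤
      ENNReal.ofReal (geodA d W a x y) := by
  refine ENNReal.le_of_forall_pos_le_add fun ε hε _ => ?_
  have hε3 : (0 : ℝ) < ε / 3 := by positivity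
  have hne : {L | ∃ γ : ℝ → Fin d → ℝ, (∃ K : NNReal, LipschitzWith K γ) ∧ (∀ t, γ t 0 = a) ∧
      γ (-1) = x ∧ γ 1 = y ∧ L = ∫ t in Set.Icc (-1 : ℝ) 1,
        Real.sqrt (2 * W (γ t)) * Real.sqrt (vnorm2 (deriv γ t))}.Nonempty := by
    obtain ⟨γ, hK, h0, hm, hp⟩ := exists_lipschitz_segment hx.1 hy.1
    exact ⟨_, γ, hK, h0, hm, hp, rfl⟩
  obtain ⟨_, ⟨β, ⟨K, hK⟩, hβ0, hβm, hβp, rfl⟩, hlt⟩ :=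
    exists_lt_of_csInf_lt hne (lt_add_of_pos_right (geodA d W a x y) hε3)
  obtain ⟨g, hg, hg0, hend, hlen⟩ :=
    exists_integrable_of_lipschitz (fun z => √(2 * W z)) hK hβ0
  rw [hβm] at hlen hend
  obtain ⟨h, hc, hs, h0, hint, hle⟩ := exists_smooth_curve (ρ := fun z => √(2 * W z))
    (by fun_prop) (fun _ => Real.sqrt_nonneg _) x hg hg0 hε3
  obtain ⟨γ, hγ, hE⟩ := exists_adm1D_energy1D_le hWc hWnn hx hy hc hs h0
    (by rw [hint, hend, hβp]) hε3
  have hpos : 0 ≤ geodA d W a x y := Real.sInf_nonneg fun L ⟨γ, _, _, _, _, hL⟩ =>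
    hL ▸ integral_nonneg fun t => by positivity
  calc _ ≤ energy1D d W γ := iInf₂_le γ hγ
    _ ≤ ENNReal.ofReal (geodA d W a x y + ε) :=
        hE.trans (ENNReal.ofReal_le_ofReal (by linarith))
    _ = _ := by rw [ENNReal.ofReal_add hpos ε.coe_nonneg, ENNReal.ofReal_coe_nnreal]

/-- Proposition `inf_1D`: the geodesic distance `geod^a_W(u⁻,u⁺)` equals
the infimum of the one-dimensional energy over curves in `Ḣ¹(ℝ, ℝ^d_a)` connecting `u⁻` to
`u⁺`; any minimizer `γ` of the 1D problem satisfies `E(γ) = L_W(γ) = geod^a_W(u⁻,u⁺)` and the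
equipartition identity `|γ̇| = √(2W(γ))` a.e. -/
theorem statement13 (d : ℕ) [NeZero d] (hd : 2 ≤ d)
    (W : (Fin d → ℝ) → ℝ) (hWc : Continuous W) (hWnn : ∀ z, 0 ≤ W z)
    (a : ℝ) (um up : Fin d → ℝ)
    (hum : um ∈ wellSet d W a) (hup : up ∈ wellSet d W a) :
    (ENNReal.ofReal (geodA d W a um up) =
      ⨅ (γ : ℝ → Fin d → ℝ) (_ : Adm1D d a um up γ), energy1D d W γ) ∧
    (∀ γ : ℝ → Fin d → ℝ, Adm1D d a um up γ →
      (∀ γ', Adm1D d a um up γ' → energy1D d W γ ≤ energy1D d W γ') →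
      energy1D d W γ = ENNReal.ofReal (geodA d W a um up) ∧
      (∫⁻ t : ℝ, ENNReal.ofReal
          (Real.sqrt (2 * W (γ t)) * Real.sqrt (vnorm2 (deriv γ t)))) =
        ENNReal.ofReal (geodA d W a um up) ∧
      ∀ᵐ t : ℝ ∂volume, vnorm2 (deriv γ t) = 2 * W (γ t)) := by
  have hlow : ∀ γ, Adm1D d a um up γ →
      ENNReal.ofReal (geodA d W a um up) ≤ energy1D d W γ := fun γ hγ => by
    by_cases hE : energy1D d W γ = ⊤
    · simp [hE]
    · exact (geodA_le_lintegral_length hWc hWnn hum hup hγ hE).trans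
        (lintegral_length_le_energy1D hWnn γ)
  have hinf := iInf_energy1D_le_geodA hWc hWnn hum hup
  refine ⟨le_antisymm (le_iInf₂ hlow) hinf, fun γ hγ hmin => ?_⟩
  have hE : energy1D d W γ = ENNReal.ofReal (geodA d W a um up) :=
    le_antisymm ((le_iInf₂ hmin).trans hinf) (hlow γ hγ)
  have hEtop : energy1D d W γ ≠ ⊤ := hE ▸ ENNReal.ofReal_ne_top
  have hL : ∫⁻ t, ENNReal.ofReal (√(2 * W (γ t)) * √(vnorm2 (deriv γ t))) =
      ENNReal.ofReal (geodA d W a um up) :=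
    le_antisymm (hE ▸ lintegral_length_le_energy1D hWnn γ)
      (geodA_le_lintegral_length hWc hWnn hum hup hγ hEtop)
  refine ⟨hE, hL, ?_⟩
  have hmeas : Measurable fun t => ENNReal.ofReal ((1 / 2) * vnorm2 (deriv γ t) + W (γ t)) :=
    (((continuous_vnorm2.measurable.comp (measurable_deriv γ)).const_mul _).add
      (hWc.comp hγ.1.continuous).measurable).ennreal_ofReal
  have hae := ae_eq_of_ae_le_of_lintegral_le
    (ae_of_all _ fun t => ENNReal.ofReal_le_ofReal
      (sqrt_mul_sqrt_vnorm2_le (hWnn (γ t)) (deriv γ t)))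
    (hL ▸ ENNReal.ofReal_ne_top) hmeas.aemeasurable (hE.trans hL.symm).le
  filter_upwards [hae] with t ht
  refine vnorm2_eq_of_sqrt_mul_sqrt_eq (hWnn _) ?_
  refine (ENNReal.ofReal_eq_ofReal_iff (by positivity) ?_).1 ht
  have := vnorm2_nonneg (deriv γ t)
  have := hWnn (γ t)
  positivity
end
end

section
/- Let d ≥ 2 and u = (u₁,…,u_d) ∈ Ḣ¹_div(Ω,ℝ^d) be such that its x'-average ū belongs to L^∞(ℝ,ℝ^d). Then ∫_Ω |∇u|² = ∫_Ω Σ_{1≤i<j≤d} |∂_i u_j − ∂_j u_i|² = ∫_Ω Σ_{1≤i<j≤d} |∂_i u_j + ∂_j u_i|² + 2 ∫_Ω Σ_{i=1}^d |∂_i u_i|². Equivalently, ‖Π⁺∇u‖²_{L²(Ω)} = ‖Π⁻∇u‖²_{L²(Ω)} = ½‖∇u‖²_{L²(Ω)}, where Π⁺ and Π⁻ are the projections onto symmetric and antisymmetric matrices, Π^±U = ½(U ± U^T). -/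
open MeasureTheory Filter Topology ENNReal

noncomputable section

/-- Period 1 in every coordinate direction other than the `0`-th. -/
def SidePeriodic {d : ℕ} [NeZero d] {α : Type*} (f : (Fin d → ℝ) → α) : Prop :=
  ∀ (x : Fin d → ℝ) (i : Fin d), i ≠ 0 → f (x + Pi.single i 1) = f x

/-- The lattice `{0} × ℤ^{d-1}`. -/
def sideLattice (d : ℕ) [NeZero d] : AddSubgroup (Fin d → ℝ) :=
  AddMonoidHom.range
    (AddMonoidHom.mk' (fun (k : Fin d → ℤ) (i : Fin d) => if i = 0 then (0 : ℝ) else (k i : ℝ))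
      (by intro a b; ext i; by_cases h : i = 0 <;> simp [h]))

instance (d : ℕ) [NeZero d] : Countable (sideLattice d) := by
  unfold sideLattice
  exact (Set.countable_range _).to_subtype

theorem SidePeriodic.add_lattice {d : ℕ} [NeZero d] {α : Type*} {f : (Fin d → ℝ) → α}
    (hf : SidePeriodic f) {g : Fin d → ℝ} (hg : g ∈ sideLattice d) (x : Fin d → ℝ) :
    f (x + g) = f x := by
  let P : AddSubgroup (Fin d → ℝ) :=
    { carrier := {g | ∀ x, f (x + g) = f x}
      zero_mem' := by simp
      add_mem' := by
        intro a b ha hb x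
        rw [← add_assoc, hb, ha]
      neg_mem' := by
        intro a ha x
        have := ha (x + -a)
        rw [neg_add_cancel_right] at this
        exact this.symm }
  suffices h : g ∈ P from h x
  obtain ⟨k, rfl⟩ := hg
  have : (AddMonoidHom.mk' (fun (k : Fin d → ℤ) (i : Fin d) => if i = 0 then (0 : ℝ) else (k i : ℝ))
      (by intro a b; ext i; by_cases h : i = 0 <;> simp [h])) k
      = ∑ i : Fin d, if i = 0 then 0 else k i • (Pi.single i (1 : ℝ) : Fin d → ℝ) := by
    ext j
    rw [Finset.sum_apply, Finset.sum_eq_single j]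
    · by_cases h : j = 0 <;> simp [h]
    · intro b _ hb
      by_cases h : b = 0
      · simp [h]
      · simp [h, Pi.single_eq_of_ne hb.symm]
    · simp
  rw [this]
  refine P.sum_mem fun i _ => ?_
  split_ifs with h
  · exact P.zero_mem
  · exact P.zsmul_mem (fun x => hf x i h) _

theorem measurableSet_strip (d : ℕ) [NeZero d] : MeasurableSet (strip d) := by
  have : strip d = ⋂ i : Fin d, ⋂ _ : i ≠ 0, (fun x : Fin d → ℝ => x i) ⁻¹' Set.Ico 0 1 := by
    ext x; simp [strip]
  rw [this]
  exact MeasurableSet.iInter fun i => MeasurableSet.iInter fun _ =>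
    (measurable_pi_apply i) measurableSet_Ico

theorem isAddFundamentalDomain_strip (d : ℕ) [NeZero d] :
    IsAddFundamentalDomain (sideLattice d) (strip d) := by
  refine IsAddFundamentalDomain.mk' (measurableSet_strip d).nullMeasurableSet fun x => ?_
  refine ⟨⟨_, ⟨fun i => -⌊x i⌋, rfl⟩⟩, ?_, ?_⟩
  · intro i hi
    simp only [AddSubgroup.vadd_def, vadd_eq_add, Pi.add_apply, AddMonoidHom.mk'_apply, hi, if_false]
    push_cast
    constructor
    · linarith [Int.floor_le (x i)]
    · linarith [Int.lt_floor_add_one (x i)]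
  · rintro ⟨_, ⟨k, rfl⟩⟩ hk
    ext i
    by_cases hi : i = 0
    · simp [hi]
    · have := hk i hi
      simp only [AddSubgroup.vadd_def, vadd_eq_add, Pi.add_apply, AddMonoidHom.mk'_apply, hi,
        if_false, Set.mem_Ico] at this
      simp only [AddMonoidHom.mk'_apply, hi, if_false]
      have h : ⌊x i⌋ = -k i := by
        rw [Int.floor_eq_iff]; push_cast; constructor <;> linarith
      rw [h, neg_neg]

theorem SidePeriodic.setLIntegral_comp_sub {d : ℕ} [NeZero d] {f : (Fin d → ℝ) → ℝ≥0∞}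
    (hf : SidePeriodic f) (y : Fin d → ℝ) :
    ∫⁻ x in strip d, f (x - y) = ∫⁻ x in strip d, f x := by
  have h2 : IsAddFundamentalDomain (sideLattice d) ((fun x => x + y) ⁻¹' strip d) := by
    refine (isAddFundamentalDomain_strip d).preimage_of_equiv
      (measurePreserving_add_right volume y).quasiMeasurePreserving
      (e := id) Function.bijective_id ?_
    intro g x
    simp [AddSubgroup.vadd_def, add_assoc]
  have h1 : ∫⁻ x in (fun x => x + y) ⁻¹' strip d, f x = ∫⁻ x in strip d, f (x - y) := by
    have := (measurePreserving_add_right volume y).setLIntegral_comp_emb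
      (measurableEmbedding_addRight y) (fun x => f (x - y)) ((fun x => x + y) ⁻¹' strip d)
    simp only [add_sub_cancel_right] at this
    rw [this, Set.image_preimage_eq]
    exact (add_right_surjective y)
  rw [← h1]
  refine h2.setLIntegral_eq (isAddFundamentalDomain_strip d) f fun g x => ?_
  rw [AddSubgroup.vadd_def, vadd_eq_add, add_comm]
  exact hf.add_lattice g.2 x

theorem SidePeriodic.locallyIntegrable {d : ℕ} [NeZero d] {f : (Fin d → ℝ) → ℝ}
    (hf : SidePeriodic f) (hm : Measurable f) (hi : IntegrableOn f (strip d)) :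
    LocallyIntegrable f := by
  intro x
  set y : Fin d → ℝ := fun i => x i - 1 / 2 with hy
  have hp : SidePeriodic fun x => ‖f x‖ₑ := fun x i h => by
    show ‖f _‖ₑ = ‖f _‖ₑ
    rw [hf x i h]
  refine ⟨(fun z => z - y) ⁻¹' strip d, ?_, hm.aestronglyMeasurable, ?_⟩
  · refine mem_of_superset (set_pi_mem_nhds (Set.toFinite Set.univ) (s := fun i => Set.Ioo (x i - 1/2) (x i + 1/2))
      fun i _ => Ioo_mem_nhds (by linarith) (by linarith)) ?_
    intro z hz i _
    have := hz i trivial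
    simp only [Pi.sub_apply, hy]
    exact ⟨by linarith [this.1], by linarith [this.2]⟩
  · rw [hasFiniteIntegral_iff_enorm]
    have := (measurePreserving_sub_right volume y).setLIntegral_comp_emb
      (measurableEmbedding_subRight y) (fun x => ‖f (x - (-y))‖ₑ) ((fun x => x - y) ⁻¹' strip d)
    simp only [sub_neg_eq_add, sub_add_cancel] at this
    rw [this, Set.image_preimage_eq _ (fun z => ⟨z + y, by simp⟩)]
    have h := hp.setLIntegral_comp_sub (-y)
    simp only [sub_neg_eq_add] at h
    rw [h]
    exact hi.2

/-- The slab `[-R,R) × [0,1)^{d-1}`. -/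
def slab (d : ℕ) [NeZero d] (R : ℝ) : Set (Fin d → ℝ) :=
  {x | x 0 ∈ Set.Ico (-R) R} ∩ strip d

theorem measurableSet_slab (d : ℕ) [NeZero d] (R : ℝ) : MeasurableSet (slab d R) :=
  ((measurable_pi_apply 0) measurableSet_Ico).inter (measurableSet_strip d)

theorem slab_eq_pi (d : ℕ) [NeZero d] (R : ℝ) :
    slab d R = Set.univ.pi fun i : Fin d =>
      Set.Ico (if i = 0 then -R else 0) (if i = 0 then R else 1) := by
  ext x
  simp only [slab, strip, Set.mem_inter_iff, Set.mem_ofPred_eq, Set.mem_pi, Set.mem_univ,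
    true_implies]
  constructor
  · rintro ⟨h0, h⟩ i
    by_cases hi : i = 0
    · subst hi; simpa using h0
    · simpa [hi] using h i hi
  · intro h
    exact ⟨by simpa using h 0, fun i hi => by simpa [hi] using h i⟩

theorem slab_ae_eq_Icc (d : ℕ) [NeZero d] (R : ℝ) :
    slab d R =ᵐ[volume] Set.Icc (fun i : Fin d => if i = 0 then -R else 0)
      (fun i : Fin d => if i = 0 then R else (1 : ℝ)) := by
  rw [slab_eq_pi]
  exact Measure.univ_pi_Ico_ae_eq_Icc

theorem Continuous.integrableOn_slab {d : ℕ} [NeZero d] {f : (Fin d → ℝ) → ℝ} (hf : Continuous f)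
    (R : ℝ) : IntegrableOn f (slab d R) := by
  rw [integrableOn_congr_set_ae (slab_ae_eq_Icc d R)]
  exact hf.continuousOn.integrableOn_compact isCompact_Icc

theorem SidePeriodic.setIntegral_divergence_nonpos {d : ℕ} [NeZero d]
    {F : Fin d → (Fin d → ℝ) → ℝ} {R : ℝ} (hR : 0 ≤ R)
    (hF : ∀ i, Differentiable ℝ (F i)) (hp : ∀ i, SidePeriodic (F i))
    (hup : ∀ x, x 0 = R → F 0 x ≤ 0) (hlo : ∀ x, x 0 = -R → 0 ≤ F 0 x)
    (hi : IntegrableOn (fun x => ∑ i, pdS i (F i) x) (slab d R)) :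
    ∫ x in slab d R, ∑ i, pdS i (F i) x ≤ 0 := by
  obtain ⟨n, rfl⟩ : ∃ n, d = n + 1 := ⟨d - 1, by have := NeZero.pos d; omega⟩
  rw [integrableOn_congr_set_ae (slab_ae_eq_Icc _ R)] at hi
  rw [setIntegral_congr_set (slab_ae_eq_Icc _ R)]
  unfold pdS at hi ⊢
  rw [integral_divergence_of_hasFDerivAt_off_countable' _ _ ?_ F (fun i x => fderiv ℝ (F i) x)
    ∅ Set.countable_empty (fun i => (hF i).continuous.continuousOn)
    (fun x _ i => (hF i x).hasFDerivAt) hi]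
  · refine Finset.sum_nonpos fun i _ => ?_
    by_cases h : i = 0
    · subst h
      refine sub_nonpos.2 (le_trans (integral_nonpos fun x => hup _ ?_)
        (integral_nonneg fun x => hlo _ ?_)) <;> simp
    · refine le_of_eq (sub_eq_zero.2 (integral_congr_ae (ae_of_all _ fun x => ?_)))
      have := hp i (Fin.insertNth (α := fun _ => ℝ) i 0 x) i h
      simp only [h, if_false]
      rw [← this]
      congr 1
      ext j
      refine Fin.succAboveCases i ?_ (fun k => ?_) j
      · simp
      · simp
  · intro i
    by_cases h : i = 0
    · simp [h, hR]
    · simp [h]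

theorem fderiv_single_apply_const {d : ℕ} [NeZero d] {θ : ℝ → ℝ} (hθ : Differentiable ℝ θ)
    (x : Fin d → ℝ) (i : Fin d) :
    pdS i (fun x => θ (x 0)) x = if i = 0 then deriv θ (x 0) else 0 := by
  have h : HasFDerivAt (fun x : Fin d → ℝ => θ (x 0))
      (deriv θ (x 0) • (ContinuousLinearMap.proj 0 : (Fin d → ℝ) →L[ℝ] ℝ)) x :=
    (hθ (x 0)).hasDerivAt.comp_hasFDerivAt x (hasFDerivAt_apply 0 x)
  unfold pdS
  rw [h.fderiv]
  by_cases hi : i = 0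
  · subst hi; simp
  · simp [hi]

theorem pdS_mul {d : ℕ} {f g : (Fin d → ℝ) → ℝ} {x : Fin d → ℝ} (i : Fin d)
    (hf : DifferentiableAt ℝ f x) (hg : DifferentiableAt ℝ g x) :
    pdS i (fun x => f x * g x) x = f x * pdS i g x + g x * pdS i f x := by
  unfold pdS
  rw [fderiv_fun_mul hf hg]
  simp

theorem measurable_pdS {d : ℕ} (i : Fin d) (f : (Fin d → ℝ) → ℝ) : Measurable (pdS i f) :=
  measurable_fderiv_apply_const ℝ f _

/-- A Hardy inequality on the strip. -/
theorem SidePeriodic.integrableOn_sq_div {d : ℕ} [NeZero d] {w : (Fin d → ℝ) → ℝ}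
    (hw : Differentiable ℝ w) (hp : SidePeriodic w)
    (hi : IntegrableOn (fun x => pdS 0 w x ^ 2) (strip d)) :
    IntegrableOn (fun x => w x ^ 2 / (1 + x 0 ^ 2)) (strip d) := by
  set θ : ℝ → ℝ := fun s => -(s / (1 + s ^ 2)) with hθ
  have hpos : ∀ s : ℝ, 0 < 1 + s ^ 2 := fun s => by positivity
  have hθd : ∀ s, HasDerivAt θ (-((1 - s ^ 2) / (1 + s ^ 2) ^ 2)) s := fun s => by
    have h := (((hasDerivAt_id s).div (((hasDerivAt_id s).pow 2).const_add 1) (hpos s).ne')).neg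
    refine h.congr_deriv ?_
    simp only [Pi.pow_apply, id]
    ring
  have hθdiff : Differentiable ℝ θ := fun s => (hθd s).differentiableAt
  have hwc := hw.continuous
  set F : Fin d → (Fin d → ℝ) → ℝ := fun i x => if i = 0 then θ (x 0) * (w x * w x) else 0 with hFdef
  have hFd : ∀ i, Differentiable ℝ (F i) := fun i => by
    by_cases h : i = 0
    · simp only [hFdef, h, if_true]
      exact (hθdiff.comp (differentiable_apply 0)).mul (hw.mul hw)
    · simp only [hFdef, h, if_false]
      exact differentiable_const _
  have hdiv : ∀ x, ∑ i, pdS i (F i) x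
      = -((1 - x 0 ^ 2) / (1 + x 0 ^ 2) ^ 2) * w x ^ 2 + 2 * θ (x 0) * w x * pdS 0 w x := by
    intro x
    rw [Finset.sum_eq_single 0]
    · simp only [hFdef, if_true]
      rw [pdS_mul (f := fun x => θ (x 0)) (g := fun x => w x * w x) 0
          ((hθdiff.comp (differentiable_apply 0)) x) ((hw.mul hw) x),
        pdS_mul 0 (hw x) (hw x), fderiv_single_apply_const hθdiff, if_pos rfl, (hθd _).deriv]
      ring
    · intro i _ h
      simp [hFdef, h, pdS]
    · simp
  have hdi : ∀ R, IntegrableOn (fun x => pdS 0 w x ^ 2) (slab d R) := fun R =>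
    hi.mono_set Set.inter_subset_right
  have hθc : Continuous fun x : Fin d → ℝ => θ (x 0) :=
    hθdiff.continuous.comp (continuous_apply 0)
  have hwθ : Continuous fun x : Fin d → ℝ => 2 * θ (x 0) * w x := (continuous_const.mul hθc).mul hwc
  have hFi : ∀ R, IntegrableOn (fun x => ∑ i, pdS i (F i) x) (slab d R) := fun R => by
    simp only [hdiv]
    refine Integrable.add ?_ ?_
    · refine Continuous.integrableOn_slab ?_ R
      have : ∀ x : Fin d → ℝ, (1 + x 0 ^ 2) ^ 2 ≠ 0 := fun x => by positivity
      fun_prop (disch := assumption)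
    · have hc : Continuous fun x : Fin d → ℝ => (2 * θ (x 0) * w x) ^ 2 := hwθ.pow 2
      refine ((hc.integrableOn_slab R).add (hdi R)).mono'
        (hwθ.measurable.mul
          (measurable_pdS 0 w)).aestronglyMeasurable (ae_of_all _ fun x => ?_)
      simp only [Pi.add_apply, Real.norm_eq_abs, abs_mul (_ * w x) (pdS 0 w x)]
      nlinarith [sq_nonneg (|2 * θ (x 0) * w x| - |pdS 0 w x|), sq_abs (2 * θ (x 0) * w x),
        sq_abs (pdS 0 w x), abs_nonneg (2 * θ (x 0) * w x), abs_nonneg (pdS 0 w x)]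
  have hdle : ∀ R, 0 ≤ R → ∫ x in slab d R, ∑ i, pdS i (F i) x ≤ 0 := fun R hR => by
    refine SidePeriodic.setIntegral_divergence_nonpos hR hFd ?_ ?_ ?_ (hFi R)
    · intro i x j hj
      have h0 : (x + Pi.single j 1 : Fin d → ℝ) 0 = x 0 := by
        simp [Pi.single_eq_of_ne (Ne.symm hj)]
      simp only [hFdef, hp x j hj, h0]
    · intro x hx
      simp only [hFdef, if_true, hx, hθ]
      have : 0 ≤ R / (1 + R ^ 2) := div_nonneg hR (hpos R).le
      nlinarith [mul_self_nonneg (w x)]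
    · intro x hx
      simp only [hFdef, if_true, hx, hθ, neg_div, neg_neg]
      have : 0 ≤ R / (1 + (-R) ^ 2) := div_nonneg hR (hpos _).le
      exact mul_nonneg this (mul_self_nonneg (w x))
  have hpt : ∀ x ∈ strip d, 1 / 4 * (w x ^ 2 / (1 + x 0 ^ 2)) ≤
      ∑ i, pdS i (F i) x + 2 * pdS 0 w x ^ 2 +
        (slab d 3).indicator (fun x => 3 / 2 * w x ^ 2) x := by
    intro x hx
    rw [hdiv]
    simp only [hθ]
    have key : ∀ s p W I : ℝ, 1 / 4 * (W ^ 2 * (1 + s ^ 2)) ≤ (s ^ 2 / 2 - 1) * W ^ 2 + I →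
        1 / 4 * (W ^ 2 * (1 + s ^ 2)) ≤ (s ^ 2 - 1) * W ^ 2 - 2 * s * W * p + 2 * p ^ 2 + I :=
      fun s p W I h => by nlinarith [sq_nonneg (2 * p - s * W)]
    have hq := hpos (x 0)
    obtain ⟨W, hW⟩ : ∃ W, w x = W * (1 + x 0 ^ 2) := ⟨w x / (1 + x 0 ^ 2), by field_simp⟩
    have h := key (x 0) (pdS 0 w x) W ((slab d 3).indicator (fun x => 3 / 2 * w x ^ 2) x) ?_
    · rw [hW] at *
      convert h using 1
      · field_simp
      · field_simp
        ring
    · by_cases h9 : x ∈ slab d 3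
      · rw [Set.indicator_of_mem h9, hW]
        have h1 : 1 ≤ 1 + x 0 ^ 2 := by nlinarith [sq_nonneg (x 0)]
        nlinarith [mul_nonneg (sq_nonneg W) (mul_self_nonneg (x 0)),
          mul_nonneg (sq_nonneg W) (sq_nonneg (x 0 ^ 2))]
      · rw [Set.indicator_of_notMem h9]
        have : 9 ≤ x 0 ^ 2 := by
          by_contra hlt
          have := abs_lt_of_sq_lt_sq' (show x 0 ^ 2 < 3 ^ 2 by linarith) (by norm_num)
          exact h9 ⟨⟨this.1.le, this.2⟩, hx⟩
        nlinarith [mul_nonneg (sq_nonneg W) (sub_nonneg.2 this)]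
  have hwi : ∀ R, IntegrableOn (fun x => 1 / 4 * (w x ^ 2 / (1 + x 0 ^ 2))) (slab d R) := fun R => by
    have : ∀ x : Fin d → ℝ, 1 + x 0 ^ 2 ≠ 0 := fun x => by positivity
    exact Continuous.integrableOn_slab (by fun_prop (disch := assumption)) R
  have h3 : Integrable ((slab d 3).indicator fun x => 3 / 2 * w x ^ 2) :=
    (Continuous.integrableOn_slab (by fun_prop) 3).integrable_indicator (measurableSet_slab d 3)
  have hbound : ∀ n : ℕ, ∫ x in slab d n, 1 / 4 * (w x ^ 2 / (1 + x 0 ^ 2)) ≤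
      2 * (∫ x in strip d, pdS 0 w x ^ 2) +
        ∫ x, (slab d 3).indicator (fun x => 3 / 2 * w x ^ 2) x := fun n => by
    calc _ ≤ ∫ x in slab d n, (∑ i, pdS i (F i) x + 2 * pdS 0 w x ^ 2 +
          (slab d 3).indicator (fun x => 3 / 2 * w x ^ 2) x) :=
          setIntegral_mono_on (hwi n)
            (((hFi n).add ((hdi n).const_mul 2)).add h3.integrableOn)
            (measurableSet_slab d n) fun x hx => hpt x hx.2
      _ = (∫ x in slab d n, ∑ i, pdS i (F i) x) + 2 * (∫ x in slab d n, pdS 0 w x ^ 2) +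
          ∫ x in slab d n, (slab d 3).indicator (fun x => 3 / 2 * w x ^ 2) x := by
          have hs : IntegrableOn (fun x => ∑ i, pdS i (F i) x + 2 * pdS 0 w x ^ 2) (slab d n) :=
            (hFi n).add ((hdi n).const_mul 2)
          rw [integral_add hs h3.integrableOn,
            integral_add (hFi n) ((hdi n).const_mul 2), integral_const_mul]
      _ ≤ _ := by
          have a1 := hdle n n.cast_nonneg
          have a2 : ∫ x in slab d n, pdS 0 w x ^ 2 ≤ ∫ x in strip d, pdS 0 w x ^ 2 :=
            setIntegral_mono_set hi (ae_of_all _ fun x => sq_nonneg _)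
              (LE.le.eventuallyLE Set.inter_subset_right)
          have a3 : ∫ x in slab d n, (slab d 3).indicator (fun x => 3 / 2 * w x ^ 2) x ≤
              ∫ x, (slab d 3).indicator (fun x => 3 / 2 * w x ^ 2) x :=
            setIntegral_le_integral h3
              (ae_of_all _ fun x => Set.indicator_nonneg (fun y _ => by positivity) x)
          linarith
  have hcover : AECover (volume.restrict (strip d)) atTop fun n : ℕ => slab d n :=
    ⟨by
      filter_upwards [ae_restrict_mem (measurableSet_strip d)] with x hx
      filter_upwards [tendsto_natCast_atTop_atTop.eventually_gt_atTop |x 0|] with n hn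
      exact ⟨⟨(abs_lt.1 hn).1.le, (abs_lt.1 hn).2⟩, hx⟩,
     fun n => measurableSet_slab d n⟩
  have hres : ∀ n : ℕ, (volume.restrict (strip d)).restrict (slab d n) =
      volume.restrict (slab d n) := fun n => by
    rw [Measure.restrict_restrict (measurableSet_slab d n),
      Set.inter_eq_left.2 (show slab d n ⊆ strip d from Set.inter_subset_right)]
  have := hcover.integrable_of_integral_bounded_of_nonneg_ae
    (f := fun x => 1 / 4 * (w x ^ 2 / (1 + x 0 ^ 2))) _
    (fun n => by rw [IntegrableOn, hres]; exact hwi n)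
    (ae_of_all _ fun x => by positivity)
    (Eventually.of_forall fun n => by rw [hres]; exact hbound n)
  refine (this.const_mul 4).congr (ae_of_all _ fun x => ?_)
  simp only []
  ring

theorem pd_apply {d : ℕ} {u : (Fin d → ℝ) → Fin d → ℝ} {x : Fin d → ℝ}
    (hu : DifferentiableAt ℝ u x) (i j : Fin d) : pd i u x j = pdS i (fun x => u x j) x := by
  unfold pd pdS
  rw [fderiv_apply hu]
  rfl

theorem measurable_pd {d : ℕ} (i j : Fin d) (u : (Fin d → ℝ) → Fin d → ℝ) :
    Measurable fun x => pd i u x j :=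
  (measurable_pi_apply j).comp (measurable_fderiv_apply_const ℝ u _)

theorem sq_pd_le_gradSq {d : ℕ} (u : (Fin d → ℝ) → Fin d → ℝ) (x : Fin d → ℝ) (i j : Fin d) :
    pd i u x j ^ 2 ≤ gradSq u x :=
  (Finset.single_le_sum (f := fun j => pd i u x j ^ 2) (fun _ _ => sq_nonneg _)
    (Finset.mem_univ j)).trans
  (Finset.single_le_sum (f := fun i => ∑ j, pd i u x j ^ 2)
    (fun _ _ => Finset.sum_nonneg fun _ _ => sq_nonneg _) (Finset.mem_univ i))

theorem integrableOn_sq_pd {d : ℕ} {u : (Fin d → ℝ) → Fin d → ℝ} {s : Set (Fin d → ℝ)}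
    (h : IntegrableOn (gradSq u) s) (i j : Fin d) :
    IntegrableOn (fun x => pd i u x j ^ 2) s :=
  h.mono' ((measurable_pd i j u).pow_const 2).aestronglyMeasurable (ae_of_all _ fun x => by
    rw [Real.norm_of_nonneg (sq_nonneg _)]
    exact sq_pd_le_gradSq u x i j)

theorem IntegrableOn.mul_of_sq {α : Type*} [MeasurableSpace α] {μ : Measure α} {s : Set α}
    {f g : α → ℝ} (hfm : Measurable f) (hgm : Measurable g)
    (hf : IntegrableOn (fun x => f x ^ 2) s μ) (hg : IntegrableOn (fun x => g x ^ 2) s μ) :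
    IntegrableOn (fun x => f x * g x) s μ :=
  (hf.add hg).mono' (hfm.mul hgm).aestronglyMeasurable (ae_of_all _ fun x => by
    simp only [Real.norm_eq_abs, abs_mul, Pi.add_apply]
    nlinarith [sq_nonneg (|f x| - |g x|), sq_abs (f x), sq_abs (g x), abs_nonneg (f x),
      abs_nonneg (g x)])

theorem integrableOn_pd_mul_pd {d : ℕ} {u v : (Fin d → ℝ) → Fin d → ℝ} {s : Set (Fin d → ℝ)}
    (hu : IntegrableOn (gradSq u) s) (hv : IntegrableOn (gradSq v) s) (i j k l : Fin d) :
    IntegrableOn (fun x => pd i u x j * pd k v x l) s :=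
  IntegrableOn.mul_of_sq (measurable_pd i j u) (measurable_pd k l v) (integrableOn_sq_pd hu i j)
    (integrableOn_sq_pd hv k l)

theorem SidePeriodic.fderiv {d : ℕ} [NeZero d] {G : Type*} [NormedAddCommGroup G]
    [NormedSpace ℝ G] {u : (Fin d → ℝ) → G} (hu : SidePeriodic u) :
    SidePeriodic (fderiv ℝ u) := by
  intro x i hi
  rw [← fderiv_comp_add_right]
  congr 1
  ext z
  exact hu z i hi

theorem IsDivFree.sum_pdS_pd_eq_zero {d : ℕ} {v : (Fin d → ℝ) → Fin d → ℝ}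
    (hdiv : IsDivFree v) (hv : ContDiff ℝ 2 v) (x : Fin d → ℝ) (j : Fin d) :
    ∑ i, pdS i (fun x => pd j v x i) x = 0 := by
  have hd : Differentiable ℝ (_root_.fderiv ℝ v) :=
    (hv.fderiv_right (m := 1) (by norm_num)).differentiable one_ne_zero
  have hsecond : ∀ i j k : Fin d, pdS i (fun x => pd j v x k) x =
      _root_.fderiv ℝ (_root_.fderiv ℝ v) x (Pi.single i 1) (Pi.single j 1) k := by
    intro i j k
    have h := ((ContinuousLinearMap.proj (R := ℝ) (φ := fun _ : Fin d => ℝ) k).comp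
      (ContinuousLinearMap.apply ℝ (Fin d → ℝ) (Pi.single j (1 : ℝ) : Fin d → ℝ))).hasFDerivAt.comp x
        (hd x).hasFDerivAt
    unfold pdS
    exact congrArg (fun L => L (Pi.single i 1)) h.fderiv
  have hsymm : ∀ i, pdS i (fun x => pd j v x i) x = pdS j (fun x => pd i v x i) x := fun i => by
    rw [hsecond, hsecond, (hv.contDiffAt.isSymmSndFDerivAt (by simp)).eq]
  have hdi : ∀ i, Differentiable ℝ fun x => pd i v x i := fun i =>
    ((ContinuousLinearMap.proj (R := ℝ) (φ := fun _ : Fin d => ℝ) i).comp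
      (ContinuousLinearMap.apply ℝ (Fin d → ℝ)
        (Pi.single i (1 : ℝ) : Fin d → ℝ))).differentiable.comp hd
  simp only [hsymm]
  unfold pdS
  have h0 : (fun x => ∑ i, pd i v x i) = fun _ => (0 : ℝ) := funext hdiv
  have := fderiv_fun_sum (𝕜 := ℝ) (u := Finset.univ) (A := fun i x => pd i v x i) (x := x)
    (fun i _ => hdi i x)
  rw [h0] at this
  have h := congrArg (fun L => L (Pi.single j 1)) this
  simpa using h.symm

theorem integral_pd_mul_pd_eq_zero_of_contDiff {d : ℕ} [NeZero d]
    {u v : (Fin d → ℝ) → Fin d → ℝ}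
    (hu : Differentiable ℝ u) (hup : IsPeriodic u) (hui : IntegrableOn (gradSq u) (strip d))
    (hv : ContDiff ℝ 2 v) (hvp : IsPeriodic v) (hvd : IsDivFree v)
    (hvi : IntegrableOn (gradSq v) (strip d)) :
    ∫ x in strip d, ∑ i, ∑ j, pd i u x j * pd j v x i = 0 := by
  have hvdiff : Differentiable ℝ v := hv.differentiable two_ne_zero
  have huj : ∀ j, Differentiable ℝ fun x => u x j := fun j => differentiable_pi.1 hu j
  have hpdv : ∀ j i, Differentiable ℝ fun x => pd j v x i := fun j i =>
    ((ContinuousLinearMap.proj (R := ℝ) (φ := fun _ : Fin d => ℝ) i).comp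
      (ContinuousLinearMap.apply ℝ (Fin d → ℝ)
        (Pi.single j (1 : ℝ) : Fin d → ℝ))).differentiable.comp
      ((hv.fderiv_right (m := 1) (by norm_num)).differentiable one_ne_zero)
  let χ : ContDiffBump (0 : ℝ) := ⟨1, 2, one_pos, one_lt_two⟩
  have hχd : Differentiable ℝ χ := (χ.contDiff (n := 1)).differentiable one_ne_zero
  obtain ⟨C, hC⟩ := ((χ.contDiff (n := 1)).continuous_deriv le_rfl).bounded_above_of_compact_support
    χ.hasCompactSupport.deriv
  have hC0 : 0 ≤ C := (norm_nonneg _).trans (hC 0)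
  have hχ0 : ∀ s, 2 < |s| → χ s = 0 ∧ deriv χ s = 0 := fun s hs => by
    have hns : s ∉ tsupport χ := by
      rw [χ.tsupport_eq]
      simpa [Metric.mem_closedBall] using hs
    exact ⟨image_eq_zero_of_notMem_tsupport hns,
      image_eq_zero_of_notMem_tsupport fun h => hns (tsupport_deriv_subset h)⟩
  set Q : (Fin d → ℝ) → ℝ := fun x => ∑ i, ∑ j, pd i u x j * pd j v x i with hQ
  have hQi : IntegrableOn Q (strip d) :=
    integrable_finsetSum _ fun i _ => integrable_finsetSum _ fun j _ =>
      integrableOn_pd_mul_pd hui hvi i j j i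
  set P : Fin d → (Fin d → ℝ) → ℝ := fun i x => ∑ j, u x j * pd j v x i with hP
  have hPd : ∀ i, Differentiable ℝ (P i) := fun i =>
    Differentiable.fun_sum fun j _ => (huj j).mul (hpdv j i)
  let T : ℕ → ℝ := fun n => n + 1
  have hT : ∀ n, 1 ≤ T n := fun n => by simp [T]
  let θ : ℕ → ℝ → ℝ := fun n s => χ (s / T n)
  have hθ : ∀ n s, HasDerivAt (θ n) (deriv χ (s / T n) / T n) s := fun n s => by
    exact ((hχd (s / T n)).hasDerivAt.comp s ((hasDerivAt_id s).div_const (T n))).congr_deriv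
      (mul_one_div _ _)
  have hθd : ∀ n, Differentiable ℝ (θ n) := fun n s => (hθ n s).differentiableAt
  let F : ℕ → Fin d → (Fin d → ℝ) → ℝ := fun n i x => θ n (x 0) * P i x
  have hθx : ∀ n, Differentiable ℝ fun x : Fin d → ℝ => θ n (x 0) := fun n =>
    (hθd n).comp (differentiable_apply 0)
  have hFd : ∀ n i, Differentiable ℝ (F n i) := fun n i => (hθx n).mul (hPd i)
  have hdiv : ∀ n x, ∑ i, pdS i (F n i) x
      = θ n (x 0) * Q x + deriv χ (x 0 / T n) / T n * P 0 x := by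
    intro n x
    have h1 : ∀ i, pdS i (F n i) x = θ n (x 0) * ∑ j, (u x j * pdS i (fun x => pd j v x i) x +
        pd i u x j * pd j v x i) + P i x * pdS i (fun x => θ n (x 0)) x := fun i => by
      rw [pdS_mul i ((hθx n) x) (hPd i x)]
      congr 2
      have := fderiv_fun_sum (𝕜 := ℝ) (u := Finset.univ)
        (A := fun j x => u x j * pd j v x i) (x := x)
        (fun j _ => ((huj j).mul (hpdv j i)) x)
      have h2 := congrArg (fun L => L (Pi.single i 1)) this
      simp only [sum_apply] at h2
      refine h2.trans (Finset.sum_congr rfl fun j _ => ?_)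
      have h3 := pdS_mul i (huj j x) (hpdv j i x)
      unfold pdS at h3 ⊢
      rw [h3, pd_apply (hu x)]
      unfold pdS
      ring
    simp only [h1, fderiv_single_apply_const (hθd n), mul_ite, mul_zero]
    rw [Finset.sum_add_distrib, ← Finset.mul_sum, Finset.sum_ite_eq' Finset.univ (0 : Fin d)]
    simp only [Finset.sum_add_distrib, Finset.mem_univ, if_true, (hθ n _).deriv]
    rw [Finset.sum_comm]
    simp only [← Finset.mul_sum, hvd.sum_pdS_pd_eq_zero hv, mul_zero, Finset.sum_const_zero,
      zero_add]
    rw [mul_comm (P 0 x)]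
  have hm : ∀ n, Measurable fun x => ∑ i, pdS i (F n i) x := fun n =>
    Finset.measurable_sum _ fun i _ => measurable_pdS i _
  have hub : ∀ j, IntegrableOn (fun x => u x j ^ 2 / (1 + x 0 ^ 2)) (strip d) := fun j => by
    refine SidePeriodic.integrableOn_sq_div (huj j)
      (fun x i hi => by show u _ j = u _ j; rw [hup x i hi]) ?_
    simpa only [pd_apply (hu _)] using integrableOn_sq_pd hui 0 j
  set B : (Fin d → ℝ) → ℝ := fun x =>
    |Q x| + C * ∑ j, (5 * (u x j ^ 2 / (1 + x 0 ^ 2)) + pd j v x 0 ^ 2) with hB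
  have hBi : IntegrableOn B (strip d) :=
    hQi.abs.add ((integrable_finsetSum _ fun j _ =>
      ((hub j).const_mul 5).add (integrableOn_sq_pd hvi j 0)).const_mul C)
  have hbd : ∀ n x, ‖∑ i, pdS i (F n i) x‖ ≤ B x := fun n x => by
    rw [hdiv]
    refine (norm_add_le _ _).trans (add_le_add ?_ ?_)
    · rw [norm_mul, Real.norm_eq_abs, Real.norm_eq_abs, abs_of_nonneg χ.nonneg]
      exact mul_le_of_le_one_left (abs_nonneg _) χ.le_one
    · have hT0 : 0 < T n := one_pos.trans_le (hT n)
      by_cases hx : 2 < |x 0 / T n|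
      · rw [(hχ0 _ hx).2]
        simp only [zero_div, zero_mul, norm_zero]
        exact mul_nonneg hC0 (Finset.sum_nonneg fun j _ => by positivity)
      · rw [norm_mul, norm_div, div_mul_eq_mul_div, mul_div_assoc]
        refine mul_le_mul (hC _) ?_ (by positivity) hC0
        rw [Real.norm_of_nonneg hT0.le, div_le_iff₀ hT0]
        refine (norm_sum_le _ _).trans ?_
        rw [Finset.sum_mul]
        refine Finset.sum_le_sum fun j _ => ?_
        rw [norm_mul, Real.norm_eq_abs, Real.norm_eq_abs]
        have h5 : 1 + x 0 ^ 2 ≤ 5 * T n ^ 2 := by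
          rw [not_lt, abs_div, abs_of_pos hT0, div_le_iff₀ hT0] at hx
          have := sq_le_sq' (by linarith [abs_nonneg (x 0)]) hx
          rw [sq_abs] at this
          nlinarith [hT n]
        have h6 : |u x j| ^ 2 ≤ 5 * (u x j ^ 2 / (1 + x 0 ^ 2)) * T n ^ 2 := by
          rw [sq_abs, mul_div_assoc', div_mul_eq_mul_div, le_div_iff₀ (by positivity)]
          nlinarith [mul_le_mul_of_nonneg_left h5 (sq_nonneg (u x j))]
        have h7 : |pd j v x 0| ^ 2 = pd j v x 0 ^ 2 := sq_abs _
        generalize 5 * (u x j ^ 2 / (1 + x 0 ^ 2)) = A at *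
        have : |u x j| * |pd j v x 0| * T n ≤ (A + pd j v x 0 ^ 2) * T n * T n := by
          nlinarith [sq_nonneg (|u x j| - |pd j v x 0| * T n), abs_nonneg (u x j),
            mul_nonneg (mul_nonneg (abs_nonneg (u x j)) (abs_nonneg (pd j v x 0))) hT0.le]
        exact le_of_mul_le_mul_right this hT0
  have hDi : ∀ n, IntegrableOn (fun x => ∑ i, pdS i (F n i) x) (strip d) := fun n =>
    hBi.mono' (hm n).aestronglyMeasurable (ae_of_all _ (hbd n))
  have hPp : ∀ i, SidePeriodic (P i) := fun i x k hk => by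
    simp only [hP, pd]
    rw [hup x k hk, SidePeriodic.fderiv hvp x k hk]
  have hzero : ∀ n, ∫ x in strip d, ∑ i, pdS i (F n i) x = 0 := fun n => by
    have hT0 : 0 < T n := one_pos.trans_le (hT n)
    have hR : 0 ≤ 3 * T n := by positivity
    have hout : ∀ x : Fin d → ℝ, 3 * T n ≤ |x 0| → 2 < |x 0 / T n| := fun x hx => by
      rw [abs_div, abs_of_pos hT0, lt_div_iff₀ hT0]
      linarith
    have hFp : ∀ i, SidePeriodic (F n i) := fun i x k hk => by
      have h0 : (x + Pi.single k 1 : Fin d → ℝ) 0 = x 0 := by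
        simp [Pi.single_eq_of_ne (Ne.symm hk)]
      simp only [F, h0, hPp i x k hk]
    have hF0 : ∀ x : Fin d → ℝ, 3 * T n ≤ |x 0| → F n 0 x = 0 := fun x hx => by
      simp only [F, θ, (hχ0 _ (hout x hx)).1, zero_mul]
    have hsub : ∫ x in slab d (3 * T n), ∑ i, pdS i (F n i) x =
        ∫ x in strip d, ∑ i, pdS i (F n i) x := by
      refine (setIntegral_eq_of_subset_of_forall_sdiff_eq_zero (measurableSet_strip d)
        Set.inter_subset_right fun x hx => ?_).symm
      have h3 : 3 * T n ≤ |x 0| := by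
        by_contra h
        rw [not_le, abs_lt] at h
        exact hx.2 ⟨⟨h.1.le, h.2⟩, hx.1⟩
      rw [hdiv]
      simp only [θ, hχ0 _ (hout x h3), zero_mul, zero_div, add_zero]
    rw [← hsub]
    have habs : ∀ x : Fin d → ℝ, (x 0 = 3 * T n ∨ x 0 = -(3 * T n)) → F n 0 x = 0 := by
      rintro x (h | h) <;> refine hF0 x (le_of_eq ?_) <;> rw [h]
      · rw [abs_of_nonneg hR]
      · rw [abs_neg, abs_of_nonneg hR]
    refine le_antisymm ?_ ?_
    · exact SidePeriodic.setIntegral_divergence_nonpos hR (hFd n) hFp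
        (fun x hx => (habs x (Or.inl hx)).le) (fun x hx => (habs x (Or.inr hx)).ge)
        ((hDi n).mono_set Set.inter_subset_right)
    · have hneg : ∀ x, ∑ i, pdS i (fun x => -F n i x) x = -∑ i, pdS i (F n i) x := fun x => by
        rw [← Finset.sum_neg_distrib]
        refine Finset.sum_congr rfl fun i _ => ?_
        unfold pdS
        rw [fderiv_fun_neg]
        rfl
      have := SidePeriodic.setIntegral_divergence_nonpos (F := fun i x => -F n i x) hR
        (fun i => (hFd n i).neg) (fun i x k hk => by simp only [hFp i x k hk])
        (fun x hx => by simp [habs x (Or.inl hx)]) (fun x hx => by simp [habs x (Or.inr hx)])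
        (by simp only [hneg]; exact ((hDi n).mono_set Set.inter_subset_right).neg)
      simp only [hneg, integral_neg] at this
      linarith
  have hlim : Tendsto (fun n => ∫ x in strip d, ∑ i, pdS i (F n i) x) atTop
      (𝓝 (∫ x in strip d, Q x)) := by
    refine tendsto_integral_of_dominated_convergence B
      (fun n => (hm n).aestronglyMeasurable) hBi (fun n => ae_of_all _ (hbd n))
      (ae_of_all _ fun x => ?_)
    simp only [hdiv]
    have hTt : Tendsto T atTop atTop :=
      tendsto_atTop_add_const_right _ _ tendsto_natCast_atTop_atTop
    have h1 : Tendsto (fun n => x 0 / T n) atTop (𝓝 0) := tendsto_const_nhds.div_atTop hTt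
    have h2 : Tendsto (fun n => θ n (x 0)) atTop (𝓝 1) := by
      have := (hχd.continuous.tendsto 0).comp h1
      rwa [χ.one_of_mem_closedBall (by simp [χ])] at this
    have h3 : Tendsto (fun n => deriv χ (x 0 / T n) / T n) atTop (𝓝 0) :=
      ((((χ.contDiff (n := 1)).continuous_deriv le_rfl).tendsto 0).comp h1).div_atTop hTt
    simpa using (h2.mul_const (Q x)).add (h3.mul_const (P 0 x))
  simp only [hzero] at hlim
  exact (tendsto_nhds_unique tendsto_const_nhds hlim).symm

open scoped Convolution ContDiff

theorem SidePeriodic.integrableOn_sq_locallyIntegrable {d : ℕ} [NeZero d] {g : (Fin d → ℝ) → ℝ}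
    (hp : SidePeriodic g) (hm : Measurable g) (hi : IntegrableOn (fun x => g x ^ 2) (strip d)) :
    LocallyIntegrable (fun x => g x ^ 2) ∧ LocallyIntegrable g := by
  have h2 : LocallyIntegrable (fun x => g x ^ 2) :=
    SidePeriodic.locallyIntegrable (fun x i h => by simp only [hp x i h]) (hm.pow_const 2) hi
  refine ⟨h2, ((locallyIntegrable_const (1 : ℝ)).add h2).mono hm.aestronglyMeasurable
    (ae_of_all _ fun x => ?_)⟩
  rw [Pi.add_apply, Real.norm_eq_abs, Real.norm_of_nonneg (by positivity)]
  nlinarith [sq_nonneg (|g x| - 1), sq_abs (g x), abs_nonneg (g x)]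

section Mollify

variable {d : ℕ} (b : ContDiffBump (0 : Fin d → ℝ))

theorem pdS_convolution {w : (Fin d → ℝ) → ℝ} (hw : Differentiable ℝ w) (j : Fin d)
    (hi : LocallyIntegrable (pdS j w)) (x : Fin d → ℝ) :
    pdS j (b.normed volume ⋆[ContinuousLinearMap.lsmul ℝ ℝ, volume] w) x =
      (b.normed volume ⋆[ContinuousLinearMap.lsmul ℝ ℝ, volume] pdS j w) x := by
  set φ := b.normed volume with hφ
  have hcs : HasCompactSupport φ := b.hasCompactSupport_normed
  have hcd : ContDiff ℝ 1 φ := b.contDiff_normed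
  have hcf : Continuous (fderiv ℝ φ) := hcd.continuous_fderiv one_ne_zero
  have h := hcs.hasFDerivAt_convolution_left (ContinuousLinearMap.lsmul ℝ ℝ) hcd
    (hw.continuous.locallyIntegrable (μ := volume)) x
  unfold pdS
  rw [h.fderiv]
  simp only [convolution_def]
  have hint : Integrable fun t =>
      (ContinuousLinearMap.lsmul ℝ ℝ : ℝ →L[ℝ] ℝ →L[ℝ] ℝ).precompL (Fin d → ℝ)
        (fderiv ℝ φ t) (w (x - t)) :=
    HasCompactSupport.convolutionExists_left _ (hcs.fderiv ℝ) hcf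
      hw.continuous.locallyIntegrable x
  rw [ContinuousLinearMap.integral_apply hint]
  have hder : ∀ t, fderiv ℝ (fun t => w (x - t)) t (Pi.single j 1) =
      -(fderiv ℝ w (x - t) (Pi.single j 1)) := fun t => by
    have h := (hw (x - t)).hasFDerivAt.comp t ((hasFDerivAt_id t).const_sub x)
    rw [show (fun t => w (x - t)) = w ∘ HSub.hSub x from rfl, h.fderiv]
    simp
  have hc1 := HasCompactSupport.convolutionExists_left (ContinuousLinearMap.lsmul ℝ ℝ) hcs
    hcd.continuous hi x
  have hgd : Differentiable ℝ fun t => w (x - t) :=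
    hw.comp (differentiable_id.const_sub x)
  have key := integral_mul_fderiv_eq_neg_fderiv_mul_of_integrable (μ := volume) (f := φ)
    (g := fun t => w (x - t)) (v := Pi.single j (1 : ℝ)) ?_ ?_ ?_
    (fun t _ => (hcd.differentiable one_ne_zero) t) (fun t _ => hgd t)
  · simp only [hder, mul_neg, integral_neg, neg_inj] at key
    simpa using key.symm
  · refine Continuous.integrable_of_hasCompactSupport
      ((hcf.clm_apply continuous_const).mul hgd.continuous) ?_
    exact (hcs.fderiv_apply ℝ _).mul_right
  · simp only [hder, mul_neg]
    exact hc1.neg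
  · exact Continuous.integrable_of_hasCompactSupport (hcd.continuous.mul hgd.continuous)
      hcs.mul_right

theorem sq_convolution_le {g : (Fin d → ℝ) → ℝ} (hg : LocallyIntegrable g)
    (hg2 : LocallyIntegrable fun x => g x ^ 2) (x : Fin d → ℝ) :
    (b.normed volume ⋆[ContinuousLinearMap.lsmul ℝ ℝ, volume] g) x ^ 2 ≤
      ∫ t, b.normed volume t * g (x - t) ^ 2 := by
  set φ := b.normed volume with hφ
  have hcs : HasCompactSupport φ := b.hasCompactSupport_normed
  have hcc : Continuous φ := b.continuous_normed
  have h1 : Integrable fun t => φ t * g (x - t) :=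
    HasCompactSupport.convolutionExists_left (ContinuousLinearMap.lsmul ℝ ℝ) hcs hcc hg x
  have h2 : Integrable fun t => φ t * g (x - t) ^ 2 :=
    HasCompactSupport.convolutionExists_left (ContinuousLinearMap.lsmul ℝ ℝ) hcs hcc hg2 x
  have h0 : Integrable φ := b.integrable_normed
  have hm : (φ ⋆[ContinuousLinearMap.lsmul ℝ ℝ, volume] g) x = ∫ t, φ t * g (x - t) := rfl
  rw [hm]
  set m := ∫ t, φ t * g (x - t) with hmdef
  have hpos : 0 ≤ ∫ t, φ t * (g (x - t) - m) ^ 2 :=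
    integral_nonneg fun t => mul_nonneg (b.nonneg_normed t) (sq_nonneg _)
  have hexp : ∀ t, φ t * (g (x - t) - m) ^ 2 =
      φ t * g (x - t) ^ 2 - (2 * m) * (φ t * g (x - t)) + m ^ 2 * φ t := fun t => by ring
  simp only [hexp] at hpos
  have hs : Integrable fun t => φ t * g (x - t) ^ 2 - (2 * m) * (φ t * g (x - t)) :=
    h2.sub (h1.const_mul _)
  rw [integral_add hs (h0.const_mul _), integral_sub h2 (h1.const_mul _), integral_const_mul,
    integral_const_mul, ← hmdef, b.integral_normed] at hpos
  nlinarith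

theorem setLIntegral_sq_convolution_le [NeZero d] {g : (Fin d → ℝ) → ℝ} (hp : SidePeriodic g)
    (hm : Measurable g) (hi : IntegrableOn (fun x => g x ^ 2) (strip d)) :
    ∫⁻ x in strip d, ENNReal.ofReal
        ((b.normed volume ⋆[ContinuousLinearMap.lsmul ℝ ℝ, volume] g) x ^ 2) ≤
      ∫⁻ x in strip d, ENNReal.ofReal (g x ^ 2) := by
  obtain ⟨hg2, hg⟩ := hp.integrableOn_sq_locallyIntegrable hm hi
  have hcc : Continuous (b.normed volume) := b.continuous_normed
  have hφm : Measurable fun t => ENNReal.ofReal (b.normed volume t) := hcc.measurable.ennreal_ofReal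
  have hsm : Measurable fun x => ENNReal.ofReal (g x ^ 2) := (hm.pow_const 2).ennreal_ofReal
  calc _ ≤ ∫⁻ x in strip d, ∫⁻ t, ENNReal.ofReal (b.normed volume t) *
        ENNReal.ofReal (g (x - t) ^ 2) := by
        refine lintegral_mono fun x => ?_
        refine (ENNReal.ofReal_le_ofReal (sq_convolution_le b hg hg2 x)).trans (le_of_eq ?_)
        have h2 : Integrable fun t => b.normed volume t * g (x - t) ^ 2 :=
          HasCompactSupport.convolutionExists_left (ContinuousLinearMap.lsmul ℝ ℝ)
            b.hasCompactSupport_normed hcc hg2 x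
        rw [ofReal_integral_eq_lintegral_ofReal h2
          (ae_of_all _ fun t => mul_nonneg (b.nonneg_normed t) (sq_nonneg _))]
        refine lintegral_congr fun t => ENNReal.ofReal_mul (b.nonneg_normed t)
    _ = ∫⁻ t, ∫⁻ x in strip d, ENNReal.ofReal (b.normed volume t) *
        ENNReal.ofReal (g (x - t) ^ 2) := by
        refine lintegral_lintegral_swap (Measurable.aemeasurable ?_)
        exact (hφm.comp measurable_snd).mul (hsm.comp (measurable_fst.sub measurable_snd))
    _ = ∫⁻ t, ENNReal.ofReal (b.normed volume t) * ∫⁻ x in strip d, ENNReal.ofReal (g x ^ 2) := by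
        refine lintegral_congr fun t => ?_
        have hs : Measurable fun x => ENNReal.ofReal (g (x - t) ^ 2) :=
          hsm.comp (measurable_id.sub_const t)
        rw [lintegral_const_mul _ hs]
        congr 1
        exact SidePeriodic.setLIntegral_comp_sub (f := fun x => ENNReal.ofReal (g x ^ 2))
          (fun x i h => by simp only [hp x i h]) t
    _ = _ := by
        rw [lintegral_mul_const _ hφm, ← ofReal_integral_eq_lintegral_ofReal b.integrable_normed
          (ae_of_all _ b.nonneg_normed), b.integral_normed, ENNReal.ofReal_one, one_mul]

theorem SidePeriodic.convolution [NeZero d] {w φ : (Fin d → ℝ) → ℝ} (hp : SidePeriodic w) :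
    SidePeriodic (φ ⋆[ContinuousLinearMap.lsmul ℝ ℝ, volume] w) := by
  intro x i hi
  simp only [convolution_def]
  congr 1
  ext t
  rw [add_sub_right_comm, hp _ i hi]

/-- Componentwise mollification of a vector field. -/
def mollify (u : (Fin d → ℝ) → Fin d → ℝ) (x : Fin d → ℝ) : Fin d → ℝ := fun i =>
  (b.normed volume ⋆[ContinuousLinearMap.lsmul ℝ ℝ, volume] fun y => u y i) x

theorem contDiff_mollify {u : (Fin d → ℝ) → Fin d → ℝ} (hu : Continuous u) :
    ContDiff ℝ 2 (mollify b u) :=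
  contDiff_pi.2 fun i => b.hasCompactSupport_normed.contDiff_convolution_left (n := 2) _
    b.contDiff_normed ((continuous_apply i).comp hu).locallyIntegrable

theorem IsPeriodic.mollify [NeZero d] {u : (Fin d → ℝ) → Fin d → ℝ} (hu : IsPeriodic u) :
    IsPeriodic (mollify b u) := fun x i hi => by
  ext k
  exact SidePeriodic.convolution (w := fun y => u y k) (fun x i hi => by simp only [hu x i hi]) x i hi

theorem IsPeriodic.pd [NeZero d] {u : (Fin d → ℝ) → Fin d → ℝ} (hu : IsPeriodic u) (i j : Fin d) :
    SidePeriodic fun x => pd i u x j := fun x k hk => by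
  simp only [_root_.pd]
  rw [SidePeriodic.fderiv hu x k hk]

theorem locallyIntegrable_pd [NeZero d] {u : (Fin d → ℝ) → Fin d → ℝ} (hp : IsPeriodic u)
    (hi : IntegrableOn (gradSq u) (strip d)) (i j : Fin d) :
    LocallyIntegrable fun x => pd i u x j :=
  ((hp.pd i j).integrableOn_sq_locallyIntegrable (measurable_pd i j u)
    (integrableOn_sq_pd hi i j)).2

theorem pd_mollify [NeZero d] {u : (Fin d → ℝ) → Fin d → ℝ} (hu : Differentiable ℝ u)
    (hp : IsPeriodic u) (hi : IntegrableOn (gradSq u) (strip d)) (i j : Fin d) (x : Fin d → ℝ) :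
    pd i (mollify b u) x j =
      (b.normed volume ⋆[ContinuousLinearMap.lsmul ℝ ℝ, volume] fun y => pd i u y j) x := by
  have h : (fun y => pd i u y j) = pdS i fun y => u y j := funext fun y => pd_apply (hu y) i j
  rw [pd_apply ((contDiff_mollify b hu.continuous).differentiable two_ne_zero x), h,
    ← pdS_convolution b (differentiable_pi.1 hu j) i (h ▸ locallyIntegrable_pd hp hi i j)]
  rfl

theorem IsDivFree.mollify [NeZero d] {u : (Fin d → ℝ) → Fin d → ℝ} (hdiv : IsDivFree u)
    (hu : Differentiable ℝ u) (hp : IsPeriodic u) (hi : IntegrableOn (gradSq u) (strip d)) :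
    IsDivFree (mollify b u) := fun x => by
  simp only [pd_mollify b hu hp hi, convolution_def]
  rw [← integral_finsetSum _ fun i _ => HasCompactSupport.convolutionExists_left
    (ContinuousLinearMap.lsmul ℝ ℝ) b.hasCompactSupport_normed b.continuous_normed
    (locallyIntegrable_pd hp hi i i) x]
  simp only [← map_sum, hdiv _, map_zero, integral_zero]

theorem integrableOn_gradSq_mollify [NeZero d] {u : (Fin d → ℝ) → Fin d → ℝ}
    (hu : Differentiable ℝ u) (hp : IsPeriodic u) (hi : IntegrableOn (gradSq u) (strip d)) :
    IntegrableOn (gradSq (mollify b u)) (strip d) ∧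
      ∫ x in strip d, gradSq (mollify b u) x ≤ ∫ x in strip d, gradSq u x := by
  have hle : ∀ i j, ∫⁻ x in strip d, ENNReal.ofReal (pd i (mollify b u) x j ^ 2) ≤
      ∫⁻ x in strip d, ENNReal.ofReal (pd i u x j ^ 2) := fun i j => by
    simp only [pd_mollify b hu hp hi]
    exact setLIntegral_sq_convolution_le b (hp.pd i j) (measurable_pd i j u)
      (integrableOn_sq_pd hi i j)
  have hsq : ∀ i j, IntegrableOn (fun x => pd i (mollify b u) x j ^ 2) (strip d) := fun i j => by
    refine ⟨((measurable_pd i j _).pow_const 2).aestronglyMeasurable, ?_⟩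
    rw [hasFiniteIntegral_iff_ofReal (ae_of_all _ fun x => sq_nonneg _)]
    refine (hle i j).trans_lt ?_
    rw [← hasFiniteIntegral_iff_ofReal (ae_of_all _ fun x => sq_nonneg _)]
    exact (integrableOn_sq_pd hi i j).2
  refine ⟨integrable_finsetSum _ fun i _ => integrable_finsetSum _ fun j _ => hsq i j, ?_⟩
  have hex : ∀ v : (Fin d → ℝ) → Fin d → ℝ,
      (∀ i j, IntegrableOn (fun x => pd i v x j ^ 2) (strip d)) →
      ∫ x in strip d, gradSq v x = ∑ i, ∑ j, ∫ x in strip d, pd i v x j ^ 2 := fun v h => by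
    unfold gradSq
    rw [integral_finsetSum _ fun i _ => integrable_finsetSum _ fun j _ => h i j]
    exact Finset.sum_congr rfl fun i _ => integral_finsetSum _ fun j _ => h i j
  rw [hex _ hsq, hex _ fun i j => integrableOn_sq_pd hi i j]
  refine Finset.sum_le_sum fun i _ => Finset.sum_le_sum fun j _ => ?_
  have h := hle i j
  rw [← ofReal_integral_eq_lintegral_ofReal (hsq i j) (ae_of_all _ fun x => sq_nonneg _),
    ← ofReal_integral_eq_lintegral_ofReal (integrableOn_sq_pd hi i j)
      (ae_of_all _ fun x => sq_nonneg _)] at h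
  exact (ENNReal.ofReal_le_ofReal_iff (integral_nonneg fun x => sq_nonneg _)).1 h

end Mollify

theorem integral_pd_mul_pd_eq_zero {d : ℕ} [NeZero d] {u : (Fin d → ℝ) → Fin d → ℝ}
    (hu : Differentiable ℝ u) (hp : IsPeriodic u) (hdiv : IsDivFree u)
    (hi : IntegrableOn (gradSq u) (strip d)) :
    ∫ x in strip d, ∑ i, ∑ j, pd i u x j * pd j u x i = 0 := by
  have hr : ∀ n : ℕ, (0 : ℝ) < 1 / (2 * (n + 1)) := fun n => by positivity
  let b : ℕ → ContDiffBump (0 : Fin d → ℝ) := fun n =>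
    ⟨1 / (2 * (n + 1)), 2 * (1 / (2 * (n + 1))), hr n, by linarith [hr n]⟩
  have hb : Tendsto (fun n => (b n).rOut) atTop (𝓝 0) := by
    have h : (fun n => (b n).rOut) = fun n : ℕ => 1 / ((n : ℝ) + 1) := by
      ext n
      simp only [b]
      field_simp
    rw [h]
    exact tendsto_one_div_add_atTop_nhds_zero_nat
  let v : ℕ → (Fin d → ℝ) → Fin d → ℝ := fun n => mollify (b n) u
  have hvi : ∀ n, IntegrableOn (gradSq (v n)) (strip d) := fun n =>
    (integrableOn_gradSq_mollify (b n) hu hp hi).1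
  have hprod : ∀ w : (Fin d → ℝ) → Fin d → ℝ, IntegrableOn (gradSq w) (strip d) →
      IntegrableOn (fun x => ∑ i, ∑ j, pd i u x j * pd j w x i) (strip d) := fun w hw =>
    integrable_finsetSum _ fun i _ => integrable_finsetSum _ fun j _ =>
      integrableOn_pd_mul_pd hi hw i j j i
  have hlim : ∀ᵐ x, ∀ i j, Tendsto (fun n => pd i (v n) x j) atTop (𝓝 (pd i u x j)) := by
    refine ae_all_iff.2 fun i => ae_all_iff.2 fun j => ?_
    have := ContDiffBump.ae_convolution_tendsto_right_of_locallyIntegrable (K := 2) hb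
      (Eventually.of_forall fun n => le_rfl) (locallyIntegrable_pd hp hi i j)
    simpa only [v, pd_mollify _ hu hp hi] using this
  have key : ∀ σ : ℝ, σ ^ 2 = 1 →
      σ * ∫ x in strip d, ∑ i, ∑ j, pd i u x j * pd j u x i ≤ 0 := by
    intro σ hσ
    let f : ((Fin d → ℝ) → Fin d → ℝ) → (Fin d → ℝ) → ℝ := fun w x =>
      1 / 2 * gradSq u x + 1 / 2 * gradSq w x + σ * ∑ i, ∑ j, pd i u x j * pd j w x i
    have hf0 : ∀ w x, 0 ≤ f w x := fun w x => by
      have h : f w x = ∑ i, ∑ j, 1 / 2 * (pd i u x j + σ * pd j w x i) ^ 2 := by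
        have hs : gradSq w x = ∑ i, ∑ j, pd j w x i ^ 2 := Finset.sum_comm
        simp only [f, hs]
        unfold gradSq
        simp only [Finset.mul_sum, ← Finset.sum_add_distrib]
        refine Finset.sum_congr rfl fun i _ => Finset.sum_congr rfl fun j _ => ?_
        linear_combination (-(1 / 2) * pd j w x i ^ 2) * hσ
      rw [h]
      exact Finset.sum_nonneg fun i _ => Finset.sum_nonneg fun j _ => by positivity
    have hfi : ∀ w, IntegrableOn (gradSq w) (strip d) → IntegrableOn (f w) (strip d) := fun w hw =>
      ((hi.const_mul _).add (hw.const_mul _)).add ((hprod w hw).const_mul σ)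
    have hfint : ∀ w, IntegrableOn (gradSq w) (strip d) → ∫ x in strip d, f w x =
        1 / 2 * (∫ x in strip d, gradSq u x) + 1 / 2 * (∫ x in strip d, gradSq w x) +
          σ * ∫ x in strip d, ∑ i, ∑ j, pd i u x j * pd j w x i := fun w hw => by
      have hs : IntegrableOn (fun x => 1 / 2 * gradSq u x + 1 / 2 * gradSq w x) (strip d) :=
        (hi.const_mul _).add (hw.const_mul _)
      simp only [f]
      rw [integral_add hs ((hprod w hw).const_mul σ),
        integral_add (hi.const_mul _) (hw.const_mul _), integral_const_mul, integral_const_mul,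
        integral_const_mul]
    have hfv : ∀ n, ∫ x in strip d, f (v n) x ≤ ∫ x in strip d, gradSq u x := fun n => by
      rw [hfint _ (hvi n), integral_pd_mul_pd_eq_zero_of_contDiff hu hp hi
        (contDiff_mollify (b n) hu.continuous) (hp.mollify (b n)) (hdiv.mollify (b n) hu hp hi)
        (hvi n)]
      linarith [(integrableOn_gradSq_mollify (b n) hu hp hi).2]
    have hfm : ∀ w, Measurable (f w) := fun w => by
      have hg : ∀ w : (Fin d → ℝ) → Fin d → ℝ, Measurable (gradSq w) := fun w =>
        Finset.measurable_sum _ fun i _ => Finset.measurable_sum _ fun j _ =>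
          (measurable_pd i j w).pow_const 2
      exact (((hg u).const_mul _).add ((hg w).const_mul _)).add
        (Measurable.const_mul (Finset.measurable_sum _ fun i _ => Finset.measurable_sum _ fun j _ =>
          (measurable_pd i j u).mul (measurable_pd j i w)) σ)
    have hflim : ∀ᵐ x ∂volume.restrict (strip d),
        ENNReal.ofReal (f u x) = liminf (fun n => ENNReal.ofReal (f (v n) x)) atTop := by
      filter_upwards [ae_restrict_of_ae hlim] with x hx
      refine (Tendsto.liminf_eq (ENNReal.tendsto_ofReal ?_)).symm
      have hg : Tendsto (fun n => gradSq (v n) x) atTop (𝓝 (gradSq u x)) :=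
        tendsto_finsetSum _ fun i _ => tendsto_finsetSum _ fun j _ => (hx i j).pow 2
      exact (tendsto_const_nhds.add (hg.const_mul _)).add (Tendsto.const_mul σ
        (tendsto_finsetSum _ fun i _ => tendsto_finsetSum _ fun j _ => (hx j i).const_mul _))
    have hofReal : ∀ w, IntegrableOn (gradSq w) (strip d) →
        ∫⁻ x in strip d, ENNReal.ofReal (f w x) = ENNReal.ofReal (∫ x in strip d, f w x) :=
      fun w hw => (ofReal_integral_eq_lintegral_ofReal (hfi w hw) (ae_of_all _ (hf0 w))).symm
    have hfatou : ENNReal.ofReal (∫ x in strip d, f u x) ≤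
        ENNReal.ofReal (∫ x in strip d, gradSq u x) := by
      rw [← hofReal u hi, lintegral_congr_ae hflim]
      refine (lintegral_liminf_le fun n => (hfm (v n)).ennreal_ofReal).trans ?_
      refine liminf_le_of_frequently_le' (Frequently.of_forall fun n => ?_)
      rw [hofReal _ (hvi n)]
      exact ENNReal.ofReal_le_ofReal (hfv n)
    have hpos : 0 ≤ ∫ x in strip d, gradSq u x := integral_nonneg fun x =>
      Finset.sum_nonneg fun i _ => Finset.sum_nonneg fun j _ => sq_nonneg _
    rw [ENNReal.ofReal_le_ofReal_iff hpos, hfint u hi] at hfatou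
    linarith
  have h1 := key 1 (by norm_num)
  have h2 := key (-1) (by norm_num)
  linarith

theorem sum_sum_ite_lt {d : ℕ} (a : Fin d → Fin d → ℝ) (hs : ∀ i j, a i j = a j i) :
    2 * (∑ i, ∑ j, if i < j then a i j else 0) = (∑ i, ∑ j, a i j) - ∑ i, a i i := by
  have h1 : ∑ i, ∑ j, a i j = (∑ i, ∑ j, if i < j then a i j else 0) +
      (∑ i, ∑ j, if j < i then a i j else 0) + ∑ i, ∑ j, if i = j then a i j else 0 := by
    simp only [← Finset.sum_add_distrib]
    refine Finset.sum_congr rfl fun i _ => Finset.sum_congr rfl fun j _ => ?_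
    rcases lt_trichotomy i j with h | h | h
    · simp [h, h.not_gt, h.ne]
    · simp [h]
    · simp [h, h.not_gt, h.ne']
  have h2 : (∑ i, ∑ j, if j < i then a i j else 0) = ∑ i, ∑ j, if i < j then a i j else 0 := by
    rw [Finset.sum_comm]
    exact Finset.sum_congr rfl fun i _ => Finset.sum_congr rfl fun j _ => by rw [hs j i]
  rw [h1, h2]
  simp
  ring

/-- Proposition `antisymgradient`: for a divergence-free map
`u ∈ Ḣ¹_div(Ω,ℝ^d)` with bounded average `ū`, the `L²(Ω)` norm of the gradient equals those
of twice its antisymmetric part and of its symmetric part: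
`∫|∇u|² = ∫ Σ_{i<j}|∂_iu_j - ∂_ju_i|² = ∫ Σ_{i<j}|∂_iu_j + ∂_ju_i|² + 2∫ Σ_i|∂_iu_i|²`,
equivalently `‖Π⁺∇u‖² = ‖Π⁻∇u‖² = ½‖∇u‖²`. -/
theorem statement16 (d : ℕ) [NeZero d] (hd : 2 ≤ d)
    (u : (Fin d → ℝ) → Fin d → ℝ)
    (hdiff : Differentiable ℝ u) (hper : IsPeriodic u) (hdiv : IsDivFree u)
    (hgl2 : IntegrableOn (gradSq u) (strip d))
    (hbnd : ∃ M : ℝ, ∀ t : ℝ, ‖avg u t‖ ≤ M) :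
    ((∫ x in strip d, gradSq u x) =
      ∫ x in strip d, ∑ i, ∑ j, if i < j then (pd i u x j - pd j u x i) ^ 2 else 0) ∧
    ((∫ x in strip d, gradSq u x) =
      (∫ x in strip d, ∑ i, ∑ j, if i < j then (pd i u x j + pd j u x i) ^ 2 else 0)
        + 2 * ∫ x in strip d, ∑ i, (pd i u x i) ^ 2) ∧
    ((∫ x in strip d, ∑ i, ∑ j, ((pd i u x j + pd j u x i) / 2) ^ 2) =
      (1 / 2) * ∫ x in strip d, gradSq u x) ∧
    ((∫ x in strip d, ∑ i, ∑ j, ((pd i u x j - pd j u x i) / 2) ^ 2) =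
      (1 / 2) * ∫ x in strip d, gradSq u x) := by
  have hzero := integral_pd_mul_pd_eq_zero hdiff hper hdiv hgl2
  have hci : IntegrableOn (fun x => ∑ i, ∑ j, pd i u x j * pd j u x i) (strip d) :=
    integrable_finsetSum _ fun i _ => integrable_finsetSum _ fun j _ =>
      integrableOn_pd_mul_pd hgl2 hgl2 i j j i
  have hcomb : ∀ c e : ℝ, ∫ x in strip d, (c * gradSq u x +
      e * ∑ i, ∑ j, pd i u x j * pd j u x i) = c * ∫ x in strip d, gradSq u x := fun c e => by
    rw [integral_add (hgl2.const_mul c) (hci.const_mul e), integral_const_mul, integral_const_mul,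
      hzero, mul_zero, add_zero]
  have hswap : ∀ x, ∑ i, ∑ j, pd j u x i ^ 2 = gradSq u x := fun x => Finset.sum_comm
  have hexp : ∀ σ x, σ ^ 2 = 1 → ∑ i, ∑ j, (pd i u x j + σ * pd j u x i) ^ 2 =
      2 * gradSq u x + 2 * σ * ∑ i, ∑ j, pd i u x j * pd j u x i := fun σ x hσ => by
    rw [two_mul]
    nth_rw 2 [← hswap]
    unfold gradSq
    simp only [Finset.mul_sum, ← Finset.sum_add_distrib]
    refine Finset.sum_congr rfl fun i _ => Finset.sum_congr rfl fun j _ => ?_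
    linear_combination (pd j u x i ^ 2) * hσ
  have hplus : ∀ x, ∑ i, ∑ j, (pd i u x j + pd j u x i) ^ 2 =
      2 * gradSq u x + 2 * ∑ i, ∑ j, pd i u x j * pd j u x i := fun x => by
    simpa using hexp 1 x (by norm_num)
  have hminus : ∀ x, ∑ i, ∑ j, (pd i u x j - pd j u x i) ^ 2 =
      2 * gradSq u x + -2 * ∑ i, ∑ j, pd i u x j * pd j u x i := fun x => by
    simpa [← sub_eq_add_neg] using hexp (-1) x (by norm_num)
  have hdi : IntegrableOn (fun x => ∑ i, pd i u x i ^ 2) (strip d) :=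
    integrable_finsetSum _ fun i _ => integrableOn_sq_pd hgl2 i i
  refine ⟨?_, ?_, ?_, ?_⟩
  · rw [← one_mul (∫ x in strip d, gradSq u x), ← hcomb 1 (-1)]
    refine integral_congr_ae (ae_of_all _ fun x => ?_)
    have h := sum_sum_ite_lt (fun i j => (pd i u x j - pd j u x i) ^ 2) fun i j => by ring
    simp only [hminus, sub_self] at h
    simp only []
    have h0 : ∑ _i : Fin d, (0 : ℝ) ^ 2 = 0 := by simp
    linarith
  · have h : ∀ x, (∑ i, ∑ j, if i < j then (pd i u x j + pd j u x i) ^ 2 else 0) =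
        (1 * gradSq u x + 1 * ∑ i, ∑ j, pd i u x j * pd j u x i) -
          2 * ∑ i, pd i u x i ^ 2 := fun x => by
      have h := sum_sum_ite_lt (fun i j => (pd i u x j + pd j u x i) ^ 2) fun i j => by ring
      have h4 : ∑ i, (pd i u x i + pd i u x i) ^ 2 = 4 * ∑ i, pd i u x i ^ 2 := by
        rw [Finset.mul_sum]
        exact Finset.sum_congr rfl fun i _ => by ring
      simp only [hplus, h4] at h
      linarith
    have hs : IntegrableOn (fun x => 1 * gradSq u x +
        1 * ∑ i, ∑ j, pd i u x j * pd j u x i) (strip d) :=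
      (hgl2.const_mul 1).add (hci.const_mul 1)
    simp only [h]
    rw [integral_sub hs (hdi.const_mul 2), hcomb, integral_const_mul]
    ring
  · rw [← hcomb (1 / 2) (1 / 2)]
    refine integral_congr_ae (ae_of_all _ fun x => ?_)
    simp only [div_pow, ← Finset.sum_div, hplus]
    ring
  · rw [← hcomb (1 / 2) (-(1 / 2))]
    refine integral_congr_ae (ae_of_all _ fun x => ?_)
    simp only [div_pow, ← Finset.sum_div, hminus]
    ring
end
end
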